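/- arXiv:1708.06631 — 2 statements merged into one kernel-verified Lean document; each statement's English description precedes it below -/
import Mathlib

section
/- Let x̄ ∈ S(v̄,p̄,q̄) be a solution of the parametric variational system v ∈ f(x,p,q) + ∂_x g(x,p) satisfying the standing assumptions (A1)–(A3), with ℛ the threshold of prox-regularity of g at (x̄,p̄) for v̂. Assume that f is locally strongly monotone in x on some neighborhood U × P × Q of (x̄,p̄,q̄) with modulus σ > ℛ. Then x̄ is a Hölderian fully stable solution corresponding to (v̄,p̄,q̄). (No differentiability of f is assumed.) -/
noncomputable section

open Filter Topology Metric Set MeasureTheory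
open scoped RealInnerProductSpace Pointwise

namespace PVS

variable {X : Type*} [NormedAddCommGroup X] [InnerProductSpace ℝ X]
variable {Y : Type*} [NormedAddCommGroup Y] [InnerProductSpace ℝ Y]
variable {W : Type*} [NormedAddCommGroup W] [InnerProductSpace ℝ W]
variable {P : Type*} [MetricSpace P]
variable {Q : Type*} [MetricSpace Q]

/-- Regular (Fréchet) subdifferential of an extended-real-valued function. -/
def regSubdiff (h : X → EReal) (x : X) : Set X :=
  {v | h x ≠ ⊤ ∧ h x ≠ ⊥ ∧ ∀ ε > (0:ℝ), ∀ᶠ u in 𝓝 x,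
      h x + ((⟪v, u - x⟫ - ε * ‖u - x‖ : ℝ) : EReal) ≤ h u}

/-- Weak sequential convergence in an inner product space. -/
def WeakTendsto (xs : ℕ → X) (x : X) : Prop :=
  ∀ z : X, Tendsto (fun k => ⟪xs k, z⟫) atTop (𝓝 ⟪x, z⟫)

/-- Limiting (Mordukhovich) subdifferential. -/
def limSubdiff (h : X → EReal) (x : X) : Set X :=
  {v | ∃ xs vs : ℕ → X, Tendsto xs atTop (𝓝 x) ∧
      Tendsto (fun k => h (xs k)) atTop (𝓝 (h x)) ∧
      (∀ k, vs k ∈ regSubdiff h (xs k)) ∧ WeakTendsto vs v}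

/-- Partial limiting subdifferential with respect to the first variable. -/
def pSubdiff {PP : Type*} (g : X → PP → EReal) (x : X) (p : PP) : Set X :=
  limSubdiff (fun x' => g x' p) x

/-- Graph of a set-valued map. -/
def gph (F : X → Set Y) : Set (X × Y) := {t | t.2 ∈ F t.1}

/-- Regular normal cone. -/
def regNC (Ω : Set X) (x : X) : Set X :=
  {v | ∀ ε > (0:ℝ), ∀ᶠ y in 𝓝[Ω] x, ⟪v, y - x⟫ ≤ ε * ‖y - x‖}

/-- Limiting normal cone. -/
def limNC (Ω : Set X) (x : X) : Set X :=
  {v | ∃ xs vs : ℕ → X, (∀ k, xs k ∈ Ω) ∧ Tendsto xs atTop (𝓝 x) ∧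
      (∀ k, vs k ∈ regNC Ω (xs k)) ∧ Tendsto vs atTop (𝓝 v)}

/-- Regular normal cone to a subset of a product of two inner product spaces,
with the Euclidean product norm. -/
def regNC2 (Ω : Set (X × Y)) (ω : X × Y) : Set (X × Y) :=
  {ζ | ∀ ε > (0:ℝ), ∀ᶠ y in 𝓝[Ω] ω,
      ⟪ζ.1, y.1 - ω.1⟫ + ⟪ζ.2, y.2 - ω.2⟫
        ≤ ε * Real.sqrt (‖y.1 - ω.1‖ ^ 2 + ‖y.2 - ω.2‖ ^ 2)}

/-- Limiting normal cone in a product of two spaces. -/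
def limNC2 (Ω : Set (X × Y)) (ω : X × Y) : Set (X × Y) :=
  {ζ | ∃ ωs ζs : ℕ → X × Y, (∀ k, ωs k ∈ Ω) ∧ Tendsto ωs atTop (𝓝 ω) ∧
      (∀ k, ζs k ∈ regNC2 Ω (ωs k)) ∧ Tendsto ζs atTop (𝓝 ζ)}

/-- Regular coderivative of a set-valued map. -/
def regCoderiv (F : X → Set Y) (u : X) (v : Y) (w : Y) : Set X :=
  {z | (z, -w) ∈ regNC2 (gph F) (u, v)}

/-- Limiting coderivative of a set-valued map. -/
def limCoderiv (F : X → Set Y) (u : X) (v : Y) (w : Y) : Set X :=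
  {z | (z, -w) ∈ limNC2 (gph F) (u, v)}

/-- Regular normal cone in a product of three inner product spaces. -/
def regNC3 (Ω : Set (X × W × Y)) (ω : X × W × Y) : Set (X × W × Y) :=
  {ζ | ∀ ε > (0:ℝ), ∀ᶠ y in 𝓝[Ω] ω,
      ⟪ζ.1, y.1 - ω.1⟫ + ⟪ζ.2.1, y.2.1 - ω.2.1⟫ + ⟪ζ.2.2, y.2.2 - ω.2.2⟫
        ≤ ε * Real.sqrt (‖y.1 - ω.1‖ ^ 2 + ‖y.2.1 - ω.2.1‖ ^ 2 + ‖y.2.2 - ω.2.2‖ ^ 2)}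

/-- Limiting normal cone in a product of three inner product spaces. -/
def limNC3 (Ω : Set (X × W × Y)) (ω : X × W × Y) : Set (X × W × Y) :=
  {ζ | ∃ ωs ζs : ℕ → X × W × Y, (∀ k, ωs k ∈ Ω) ∧ Tendsto ωs atTop (𝓝 ω) ∧
      (∀ k, ζs k ∈ regNC3 Ω (ωs k)) ∧ Tendsto ζs atTop (𝓝 ζ)}

/-- Limiting coderivative of the full partial subdifferential map (x,p) ↦ ∂ₓ g(x,p). -/
def limCoderivFull (g : X → W → EReal) (xb : X) (pb : W) (vh : X) (w : X) : Set (X × W) :=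
  {zs | (zs.1, zs.2, -w) ∈ limNC3 {t : X × W × X | t.2.2 ∈ pSubdiff g t.1 t.2.1} (xb, pb, vh)}

/-- Lipschitz-like (Aubin) property of a set-valued map around a graph point. -/
def LipschitzLike {α Z : Type*} [MetricSpace α] [SeminormedAddCommGroup Z]
    (F : α → Set Z) (ab : α) (zb : Z) : Prop :=
  ∃ ℓ > (0:ℝ), ∃ U ∈ 𝓝 ab, ∃ V ∈ 𝓝 zb,
    ∀ a ∈ U, ∀ a' ∈ U, ∀ z ∈ F a ∩ V, ∃ z' ∈ F a', ‖z - z'‖ ≤ ℓ * dist a a'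

/-- Epigraph of g(·,p). -/
def epi {PP : Type*} (g : X → PP → EReal) (p : PP) : Set (X × ℝ) :=
  {q | g q.1 p ≤ (q.2 : EReal)}

/-- (A1): Lipschitz continuity of the base around the reference point. -/
def A1 (f : X → P → Q → X) (xb : X) (pb : P) (qb : Q) : Prop :=
  ∃ L > (0:ℝ), ∃ ε > (0:ℝ), ∀ x₁ x₂ p₁ p₂ q₁ q₂,
    ‖x₁ - xb‖ < ε → ‖x₂ - xb‖ < ε → dist p₁ pb < ε → dist p₂ pb < ε →
    dist q₁ qb < ε → dist q₂ qb < ε →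
    ‖f x₁ p₁ q₁ - f x₂ p₂ q₂‖ ≤ L * (‖x₁ - x₂‖ + dist p₁ p₂ + dist q₁ q₂)

/-- Parametric prox-regularity with prox-parameter r. -/
def ProxRegWith (g : X → P → EReal) (xb : X) (pb : P) (vh : X) (r : ℝ) : Prop :=
  ∃ ε > (0:ℝ), ∀ x u p v, ‖x - xb‖ < ε → ‖u - xb‖ < ε → dist p pb < ε → ‖v - vh‖ < ε →
    v ∈ pSubdiff g u p →
    g u p + ((⟪v, x - u⟫ - r / 2 * ‖x - u‖ ^ 2 : ℝ) : EReal) ≤ g x p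

/-- Subdifferential continuity with compatible parameterization. -/
def SubdiffCont (g : X → P → EReal) (xb : X) (pb : P) (vh : X) : Prop :=
  Tendsto (fun t : X × P × X => g t.1 t.2.1)
    (𝓝[{t : X × P × X | t.2.2 ∈ pSubdiff g t.1 t.2.1}] (xb, pb, vh)) (𝓝 (g xb pb))

/-- (A2): parametric continuous prox-regularity. -/
def A2 (g : X → P → EReal) (xb : X) (pb : P) (vh : X) : Prop :=
  (∃ r > (0:ℝ), ProxRegWith g xb pb vh r) ∧ SubdiffCont g xb pb vh

/-- Threshold of prox-regularity. -/
def proxThreshold (g : X → P → EReal) (xb : X) (pb : P) (vh : X) : ℝ :=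
  sInf {r : ℝ | 0 < r ∧ ProxRegWith g xb pb vh r}

/-- (A3): basic constraint qualification. -/
def A3 (g : X → P → EReal) (xb : X) (pb : P) : Prop :=
  LipschitzLike (fun p => epi g p) pb (xb, (g xb pb).toReal)

/-- (A4): uniform partial differentiability with partial Jacobian continuous at the point. -/
def A4 (f : X → P → Q → X) (Df : X → P → Q → X →L[ℝ] X) (xb : X) (pb : P) (qb : Q) : Prop :=
  (∃ η > (0:ℝ), ∀ ε > (0:ℝ), ∃ δ > (0:ℝ), ∀ x p q,
      ‖x - xb‖ < η → dist p pb < η → dist q qb < η →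
      ∀ x', ‖x' - x‖ < δ →
        ‖f x' p q - f x p q - Df x p q (x' - x)‖ ≤ ε * ‖x' - x‖) ∧
  Tendsto (fun t : X × P × Q => Df t.1 t.2.1 t.2.2) (𝓝 (xb, pb, qb)) (𝓝 (Df xb pb qb))

/-- Solution map of the parametric variational system. -/
def SolMap (f : X → P → Q → X) (g : X → P → EReal) (v : X) (p : P) (q : Q) : Set X :=
  {x | v - f x p q ∈ pSubdiff g x p}

/-- Single-valued localization of a three-parametric solution map. -/
def Localizes3 (S : X → P → Q → Set X) (V : Set X) (Pn : Set P) (Qn : Set Q) (U : Set X)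
    (ϑ : X → P → Q → X) : Prop :=
  ∀ v ∈ V, ∀ p ∈ Pn, ∀ q ∈ Qn,
    ϑ v p q ∈ U ∧ ϑ v p q ∈ S v p q ∧ ∀ x ∈ U, x ∈ S v p q → x = ϑ v p q

/-- Lipschitzian full stability. -/
def LipFullStable (S : X → P → Q → Set X) (xb vb : X) (pb : P) (qb : Q) : Prop :=
  ∃ V ∈ 𝓝 vb, ∃ Pn ∈ 𝓝 pb, ∃ Qn ∈ 𝓝 qb, ∃ U ∈ 𝓝 xb, ∃ ϑ : X → P → Q → X,
    Localizes3 S V Pn Qn U ϑ ∧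
    ∃ κ > (0:ℝ), ∃ ℓ > (0:ℝ), ∀ v₁ ∈ V, ∀ p₁ ∈ Pn, ∀ q₁ ∈ Qn, ∀ v₂ ∈ V, ∀ p₂ ∈ Pn, ∀ q₂ ∈ Qn,
      ‖(v₁ - v₂) - (2 * κ) • (ϑ v₁ p₁ q₁ - ϑ v₂ p₂ q₂)‖
        ≤ ‖v₁ - v₂‖ + ℓ * (dist p₁ p₂ + dist q₁ q₂)

/-- Hölderian full stability with given moduli. -/
def HolderFullStableWith (S : X → P → Q → Set X) (xb vb : X) (pb : P) (qb : Q) (κ ℓ : ℝ) : Prop :=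
  ∃ V ∈ 𝓝 vb, ∃ Pn ∈ 𝓝 pb, ∃ Qn ∈ 𝓝 qb, ∃ U ∈ 𝓝 xb, ∃ ϑ : X → P → Q → X,
    Localizes3 S V Pn Qn U ϑ ∧
    ∀ v₁ ∈ V, ∀ p₁ ∈ Pn, ∀ q₁ ∈ Qn, ∀ v₂ ∈ V, ∀ p₂ ∈ Pn, ∀ q₂ ∈ Qn,
      ‖(v₁ - v₂) - (2 * κ) • (ϑ v₁ p₁ q₁ - ϑ v₂ p₂ q₂)‖
        ≤ ‖v₁ - v₂‖ + ℓ * (Real.sqrt (dist p₁ p₂) + dist q₁ q₂)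

/-- Hölderian full stability. -/
def HolderFullStable (S : X → P → Q → Set X) (xb vb : X) (pb : P) (qb : Q) : Prop :=
  ∃ κ > (0:ℝ), ∃ ℓ > (0:ℝ), HolderFullStableWith S xb vb pb qb κ ℓ

/-- Neighborhood second-order condition via the regular coderivative of ∂g_p. -/
def SOC (g : X → P → EReal) (A : X →L[ℝ] X) (xb : X) (pb : P) (vh : X) (η κ₀ : ℝ) : Prop :=
  ∀ u p v, ‖u - xb‖ ≤ η → dist p pb ≤ η → ‖v - vh‖ ≤ η → v ∈ pSubdiff g u p →
    ∀ w z, z ∈ regCoderiv (fun y => pSubdiff g y p) u v w →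
      κ₀ * ‖w‖ ^ 2 ≤ ⟪A w, w⟫ + ⟪z, w⟫

/-- The graphical map p ↦ gph ∂ₓ g(·,p). -/
def gphMap (g : X → P → EReal) (p : P) : Set (X × X) := {t | t.2 ∈ pSubdiff g t.1 p}

/-- Local strong monotonicity of f in x with modulus σ. -/
def StrongMono (f : X → P → Q → X) (xb : X) (pb : P) (qb : Q) (σ : ℝ) : Prop :=
  ∃ ε > (0:ℝ), ∀ x₁ x₂ p q, ‖x₁ - xb‖ < ε → ‖x₂ - xb‖ < ε → dist p pb < ε → dist q qb < ε →
    σ * ‖x₁ - x₂‖ ^ 2 ≤ ⟪f x₁ p q - f x₂ p q, x₁ - x₂⟫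

/-- The proximal mapping P_λ(v,p) = {x : v ∈ x + λ ∂ₓ g(x,p)}. -/
def proxMap (g : X → P → EReal) (lam : ℝ) (v : X) (p : P) : Set X :=
  {x | ∃ s ∈ pSubdiff g x p, v = x + lam • s}

/-- Single-valued localization of a two-parametric solution map. -/
def Localizes2 (S : X → P → Set X) (V : Set X) (Pn : Set P) (U : Set X) (ϑ : X → P → X) : Prop :=
  ∀ v ∈ V, ∀ p ∈ Pn, ϑ v p ∈ U ∧ ϑ v p ∈ S v p ∧ ∀ x ∈ U, x ∈ S v p → x = ϑ v p

/-- (Lipschitzian) full stability of a two-parametric system. -/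
def FullStable2 (S : X → P → Set X) (xb vb : X) (pb : P) : Prop :=
  ∃ V ∈ 𝓝 vb, ∃ Pn ∈ 𝓝 pb, ∃ U ∈ 𝓝 xb, ∃ ϑ : X → P → X,
    Localizes2 S V Pn U ϑ ∧
    ∃ κ > (0:ℝ), ∃ ℓ > (0:ℝ), ∀ v₁ ∈ V, ∀ p₁ ∈ Pn, ∀ v₂ ∈ V, ∀ p₂ ∈ Pn,
      ‖(v₁ - v₂) - (2 * κ) • (ϑ v₁ p₁ - ϑ v₂ p₂)‖ ≤ ‖v₁ - v₂‖ + ℓ * dist p₁ p₂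

/-- Normal cone of convex analysis. -/
def convNC (C : Set X) (x : X) : Set X := {v | x ∈ C ∧ ∀ y ∈ C, ⟪v, y - x⟫ ≤ 0}

/-- Solution map of a parametric variational inequality. -/
def SolMapVI (f : X → P → X) (C : Set X) (v : X) (p : P) : Set X :=
  {x | v - f x p ∈ convNC C x}

/-- Radial cone. -/
def radialCone (C : Set X) (x : X) : Set X := {w | ∃ t > (0:ℝ), x + t • w ∈ C}

/-- Tangent cone (closure of the radial cone). -/
def tangentC (C : Set X) (x : X) : Set X := closure (radialCone C x)

/-- Critical cone. -/
def criticalCone (C : Set X) (x v : X) : Set X := tangentC C x ∩ {w | ⟪v, w⟫ = 0}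

/-- Polyhedricity of a closed convex set. -/
def Polyhedric (C : Set X) : Prop :=
  ∀ x ∈ C, ∀ v ∈ convNC C x,
    criticalCone C x v = closure (radialCone C x ∩ {w | ⟪v, w⟫ = 0})

/-- Weak sequential outer limit of critical cones. -/
def Hw (C : Set X) (xb vh : X) : Set X :=
  {w | ∃ xs vs ws : ℕ → X, (∀ k, vs k ∈ convNC C (xs k)) ∧
      Tendsto xs atTop (𝓝 xb) ∧ Tendsto vs atTop (𝓝 vh) ∧
      (∀ k, ws k ∈ criticalCone C (xs k) (vs k)) ∧ WeakTendsto ws w}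

/-- Strong sequential outer limit of critical cones. -/
def Hs (C : Set X) (xb vh : X) : Set X :=
  {w | ∃ xs vs ws : ℕ → X, (∀ k, vs k ∈ convNC C (xs k)) ∧
      Tendsto xs atTop (𝓝 xb) ∧ Tendsto vs atTop (𝓝 vh) ∧
      (∀ k, ws k ∈ criticalCone C (xs k) (vs k)) ∧ Tendsto ws atTop (𝓝 w)}

/-- Convex polyhedron: finite intersection of closed half-spaces. -/
def IsPolyhedron (C : Set X) : Prop :=
  ∃ (k : ℕ) (a : Fin k → X) (b : Fin k → ℝ), C = {x | ∀ i, ⟪a i, x⟫ ≤ b i}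

/-- Legendre form. -/
def LegendreForm (Qf : X → ℝ) : Prop :=
  (∃ A : X →L[ℝ] X, ∀ x, Qf x = ⟪A x, x⟫) ∧
  (∀ (xs : ℕ → X) (x : X), WeakTendsto xs x → Qf x ≤ liminf (fun k => Qf (xs k)) atTop) ∧
  (∀ (xs : ℕ → X) (x : X), WeakTendsto xs x →
     Tendsto (fun k => Qf (xs k)) atTop (𝓝 (Qf x)) → Tendsto xs atTop (𝓝 x))

/-- (A1) for a two-parametric base mapping. -/
def A1two (f : X → P → X) (xb : X) (pb : P) : Prop :=
  ∃ L > (0:ℝ), ∃ ε > (0:ℝ), ∀ x₁ x₂ p₁ p₂,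
    ‖x₁ - xb‖ < ε → ‖x₂ - xb‖ < ε → dist p₁ pb < ε → dist p₂ pb < ε →
    ‖f x₁ p₁ - f x₂ p₂‖ ≤ L * (‖x₁ - x₂‖ + dist p₁ p₂)

/-- (A4) for a two-parametric base mapping. -/
def A4two (f : X → P → X) (Df : X → P → X →L[ℝ] X) (xb : X) (pb : P) : Prop :=
  (∃ η > (0:ℝ), ∀ ε > (0:ℝ), ∃ δ > (0:ℝ), ∀ x p,
      ‖x - xb‖ < η → dist p pb < η →
      ∀ x', ‖x' - x‖ < δ → ‖f x' p - f x p - Df x p (x' - x)‖ ≤ ε * ‖x' - x‖) ∧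
  Tendsto (fun t : X × P => Df t.1 t.2) (𝓝 (xb, pb)) (𝓝 (Df xb pb))

/-- Euclidean distance in X × ℝ. -/
def pairDist (a b : X × ℝ) : ℝ := Real.sqrt (‖a.1 - b.1‖ ^ 2 + |a.2 - b.2| ^ 2)

/-- Pompeiu–Hausdorff distance between subsets of X × ℝ (Euclidean product norm). -/
def hausPH (C₁ C₂ : Set (X × ℝ)) : ℝ :=
  sInf {η : ℝ | 0 ≤ η ∧ (∀ a ∈ C₁, ∃ b ∈ C₂, pairDist a b ≤ η) ∧
                 ∀ b ∈ C₂, ∃ a ∈ C₁, pairDist a b ≤ η}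

/-- Nonparametric prox-regularity with parameter r. -/
def ProxRegWithNP (g : X → EReal) (xb vh : X) (r : ℝ) : Prop :=
  ∃ ε > (0:ℝ), ∀ x u v, ‖x - xb‖ < ε → ‖u - xb‖ < ε → ‖v - vh‖ < ε →
    v ∈ limSubdiff g u → g u ≤ g xb + (ε : EReal) →
    g u + ((⟪v, x - u⟫ - r / 2 * ‖x - u‖ ^ 2 : ℝ) : EReal) ≤ g x

/-- Nonparametric subdifferential continuity. -/
def SubdiffContNP (g : X → EReal) (xb vh : X) : Prop :=
  Tendsto (fun t : X × X => g t.1) (𝓝[gph (limSubdiff g)] (xb, vh)) (𝓝 (g xb))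

/-- Nonparametric threshold of prox-regularity. -/
def proxThresholdNP (g : X → EReal) (xb vh : X) : ℝ :=
  sInf {r : ℝ | 0 < r ∧ ProxRegWithNP g xb vh r}

/-- A smooth variational principle of Borwein–Preiss type: on a bounded closed set, a lower
semicontinuous function bounded from below is supported at some point by an arbitrarily flat
concave quadratic function. -/
theorem exists_quadratic_support [CompleteSpace X] {D : Set X} (hD : IsClosed D)
    (hne : D.Nonempty) {R : ℝ} (hR : ∀ x ∈ D, ∀ y ∈ D, ‖x - y‖ ≤ R) {F : X → ℝ}
    (hF : LowerSemicontinuousOn F D) (hbdd : BddBelow (F '' D)) {τ : ℝ} (hτ : 0 < τ) :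
    ∃ x ∈ D, ∃ e : X, ∃ M : ℝ, 0 ≤ M ∧ M ≤ τ ∧ ‖e‖ ≤ τ ∧
      ∀ u ∈ D, F x + ⟪e, u - x⟫ - M * ‖u - x‖ ^ 2 ≤ F u := by
  obtain ⟨z₀, hz₀⟩ := hne
  have hR0 : 0 ≤ R := by simpa using hR z₀ hz₀ z₀ hz₀
  obtain ⟨m, hm⟩ := hbdd
  have hm' : ∀ u ∈ D, m ≤ F u := fun u hu => hm ⟨u, hu, rfl⟩
  have hDb : ∀ u ∈ D, ‖u‖ ≤ R + ‖z₀‖ := fun u hu => by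
    calc ‖u‖ = ‖(u - z₀) + z₀‖ := by simp
      _ ≤ ‖u - z₀‖ + ‖z₀‖ := norm_add_le _ _
      _ ≤ _ := by gcongr; exact hR u hu z₀ hz₀
  -- approximate minimizers of the quadratically perturbed function
  have hpick : ∀ (a : ℝ) (b : X) (ε : ℝ), ∃ x : X, 0 ≤ a → 0 < ε → x ∈ D ∧
      ∀ u ∈ D, F x + a * ‖x‖ ^ 2 - 2 * ⟪b, x⟫ ≤ F u + a * ‖u‖ ^ 2 - 2 * ⟪b, u⟫ + ε := by
    intro a b ε
    by_cases h : 0 ≤ a ∧ 0 < ε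
    · obtain ⟨ha, hε⟩ := h
      set S := (fun u => F u + a * ‖u‖ ^ 2 - 2 * ⟪b, u⟫) '' D with hS
      have hSb : BddBelow S := by
        refine ⟨m - 2 * (‖b‖ * (R + ‖z₀‖)), ?_⟩
        rintro _ ⟨u, hu, rfl⟩
        have h1 := hm' u hu
        have h2 := real_inner_le_norm b u
        have h3 : ‖b‖ * ‖u‖ ≤ ‖b‖ * (R + ‖z₀‖) := by gcongr; exact hDb u hu
        have h4 : 0 ≤ a * ‖u‖ ^ 2 := by positivity
        simp only
        linarith
      have hSn : S.Nonempty := ⟨_, z₀, hz₀, rfl⟩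
      obtain ⟨_, ⟨x, hx, rfl⟩, hlt⟩ := exists_lt_of_csInf_lt hSn (lt_add_of_pos_right (sInf S) hε)
      refine ⟨x, fun _ _ => ⟨hx, fun u hu => ?_⟩⟩
      have := csInf_le hSb ⟨u, hu, rfl⟩
      simp only at this hlt
      linarith
    · exact ⟨z₀, fun ha hε => absurd ⟨ha, hε⟩ h⟩
  choose pick hpick using hpick
  obtain ⟨t, ht, ht1, ht2⟩ : ∃ t : ℝ, 0 < t ∧ 2 * t ≤ τ ∧ 4 * t * R ≤ τ := by
    refine ⟨τ / (4 * (R + 1)), by positivity, ?_, ?_⟩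
    · rw [mul_div_assoc', div_le_iff₀ (by positivity)]
      nlinarith
    · rw [mul_div_assoc', div_mul_eq_mul_div, div_le_iff₀ (by positivity)]
      nlinarith
  set A : ℕ → ℝ := fun k => 2 * t * (1 - (1 / 2 : ℝ) ^ k) with hA
  set ε : ℕ → ℝ := fun k => t * ((1 / 2 : ℝ) ^ k) ^ 3 / 2 with hε
  let b : ℕ → X := fun k => Nat.rec 0
    (fun k b => b + (t * (1 / 2 : ℝ) ^ k) • pick (A k) b (ε k)) k
  set xs : ℕ → X := fun k => pick (A k) (b k) (ε k) with hxs
  have hb0 : b 0 = 0 := rfl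
  have hbs : ∀ k, b (k + 1) = b k + (t * (1 / 2 : ℝ) ^ k) • xs k := fun k => rfl
  have hA0 : ∀ k, 0 ≤ A k := fun k => by
    have : (1 / 2 : ℝ) ^ k ≤ 1 := pow_le_one₀ (by norm_num) (by norm_num)
    have : 0 ≤ 1 - (1 / 2 : ℝ) ^ k := by linarith
    simp only [hA]; positivity
  have hAs : ∀ k, A (k + 1) = A k + t * (1 / 2 : ℝ) ^ k := fun k => by
    simp only [hA]; ring
  have hA2 : ∀ k, A k ≤ 2 * t := fun k => by
    have : 0 ≤ t * (1 / 2 : ℝ) ^ k := by positivity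
    simp only [hA]; linarith
  have hε0 : ∀ k, 0 < ε k := fun k => by simp only [hε]; positivity
  have hxD : ∀ k, xs k ∈ D := fun k => (hpick _ _ _ (hA0 k) (hε0 k)).1
  have hmin : ∀ k, ∀ u ∈ D, F (xs k) + A k * ‖xs k‖ ^ 2 - 2 * ⟪b k, xs k⟫
      ≤ F u + A k * ‖u‖ ^ 2 - 2 * ⟪b k, u⟫ + ε k :=
    fun k => (hpick _ _ _ (hA0 k) (hε0 k)).2
  have hcx : CauchySeq xs := by
    refine cauchySeq_of_le_geometric (1 / 2) 1 (by norm_num) fun k => ?_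
    have h1 := hmin k (xs (k + 1)) (hxD _)
    have h2 := hmin (k + 1) (xs k) (hxD _)
    rw [hAs, hbs] at h2
    simp only [inner_add_left, real_inner_smul_left, real_inner_self_eq_norm_sq] at h2
    have h3 := norm_sub_sq_real (xs k) (xs (k + 1))
    set a := (1 / 2 : ℝ) ^ k with ha
    have ha0 : 0 < a := by positivity
    have h4 : ε k + ε (k + 1) ≤ t * a * a ^ 2 := by
      have : ε k + ε (k + 1) = t * a ^ 3 * (9 / 16) := by
        simp only [hε, pow_succ (1 / 2 : ℝ) k, ← ha]; ring
      rw [this]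
      have : 0 < t * a ^ 3 := by positivity
      linarith
    have h5 : t * a * ‖xs k - xs (k + 1)‖ ^ 2 ≤ t * a * a ^ 2 := by
      rw [h3]; linarith
    have h6 := le_of_mul_le_mul_left h5 (by positivity)
    rw [dist_eq_norm, one_mul]
    exact (pow_le_pow_iff_left₀ (norm_nonneg _) ha0.le two_ne_zero).1 h6
  obtain ⟨x, hx⟩ := cauchySeq_tendsto_of_complete hcx
  have hxmem : x ∈ D := hD.mem_of_tendsto hx (Eventually.of_forall hxD)
  have hcb : CauchySeq b := by
    refine cauchySeq_of_le_geometric (1 / 2) (t * (R + ‖z₀‖)) (by norm_num) fun k => ?_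
    rw [hbs, dist_eq_norm, sub_add_cancel_left, norm_neg, norm_smul, Real.norm_of_nonneg
      (by positivity)]
    have := hDb _ (hxD k)
    calc t * (1 / 2 : ℝ) ^ k * ‖xs k‖ ≤ t * (1 / 2 : ℝ) ^ k * (R + ‖z₀‖) := by gcongr
      _ = _ := by ring
  obtain ⟨β, hβ⟩ := cauchySeq_tendsto_of_complete hcb
  have hp0 : Tendsto (fun k : ℕ => (1 / 2 : ℝ) ^ k) atTop (𝓝 0) :=
    tendsto_pow_atTop_nhds_zero_of_lt_one (by norm_num) (by norm_num)
  have hAt : Tendsto A atTop (𝓝 (2 * t)) := by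
    have := (hp0.const_sub 1).const_mul (2 * t)
    rwa [sub_zero, mul_one] at this
  have hεt : Tendsto ε atTop (𝓝 0) := by
    have := ((hp0.pow 3).const_mul t).div_const 2
    rwa [zero_pow three_ne_zero, mul_zero, zero_div] at this
  have hnorm : ∀ k, ‖A k • x - b k‖ ≤ A k * R := by
    intro k
    induction k with
    | zero => simp [hA, hb0]
    | succ k ih =>
      have : A (k + 1) • x - b (k + 1)
          = (A k • x - b k) + (t * (1 / 2 : ℝ) ^ k) • (x - xs k) := by
        rw [hAs, hbs]; module
      rw [this, hAs]
      refine (norm_add_le _ _).trans ?_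
      rw [norm_smul, Real.norm_of_nonneg (by positivity), add_mul]
      gcongr
      exact hR _ hxmem _ (hxD k)
  have hnorm' : ‖(2 * t) • x - β‖ ≤ 2 * t * R :=
    le_of_tendsto_of_tendsto' ((hAt.smul_const x).sub hβ).norm (hAt.mul_const R) hnorm
  refine ⟨x, hxmem, (-2 : ℝ) • ((2 * t) • x - β), 2 * t, by positivity, ht1, ?_, ?_⟩
  · rw [norm_smul]
    norm_num
    linarith
  intro u hu
  rw [sub_le_iff_le_add, ← le_sub_iff_add_le]
  refine le_of_forall_lt fun y hy => ?_
  obtain ⟨y', hy', hy'x⟩ := exists_between hy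
  refine lt_of_lt_of_le hy' ?_
  have hev : ∀ᶠ k in atTop, y' < F (xs k) :=
    (tendsto_nhdsWithin_iff.2 ⟨hx, Eventually.of_forall hxD⟩).eventually (hF x hxmem y' hy'x)
  have hlim : Tendsto (fun k => F u + A k * (‖u‖ ^ 2 - ‖xs k‖ ^ 2) - 2 * ⟪b k, u - xs k⟫ + ε k)
      atTop (𝓝 (F u + 2 * t * (‖u‖ ^ 2 - ‖x‖ ^ 2) - 2 * ⟪β, u - x⟫ + 0)) :=
    (((hAt.mul ((hx.norm.pow 2).const_sub _)).const_add _).sub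
      ((hβ.inner (hx.const_sub u)).const_mul 2)).add hεt
  have hle : y' ≤ F u + 2 * t * (‖u‖ ^ 2 - ‖x‖ ^ 2) - 2 * ⟪β, u - x⟫ + 0 := by
    refine ge_of_tendsto hlim (hev.mono fun k hk => ?_)
    have h1 := hmin k u hu
    rw [inner_sub_right]
    linarith
  refine hle.trans (le_of_eq ?_)
  have h3 := norm_sub_sq_real u x
  simp only [inner_sub_right, inner_sub_left, real_inner_smul_left, h3,
    real_inner_self_eq_norm_sq, real_inner_comm u x]
  ring

theorem regSubdiff_subset_limSubdiff (h : X → EReal) (x : X) :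
    regSubdiff h x ⊆ limSubdiff h x := fun v hv =>
  ⟨fun _ => x, fun _ => v, tendsto_const_nhds, tendsto_const_nhds, fun _ => hv,
    fun _ => tendsto_const_nhds⟩

theorem ne_top_of_mem_limSubdiff {h : X → EReal} {u v : X} (hv : v ∈ limSubdiff h u)
    (hmin : ∀ᶠ x in 𝓝 u, ∃ c : ℝ, h u + (c : EReal) ≤ h x) : h u ≠ ⊤ := by
  obtain ⟨xs, vs, hxs, -, hreg, -⟩ := hv
  intro htop
  obtain ⟨k, c, hc⟩ := (hxs.eventually hmin).exists
  rw [htop, EReal.top_add_coe, top_le_iff] at hc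
  exact (hreg k).1 hc

/-- Uniform constants for the assumptions on `g` near the reference point: prox-regularity with
parameter `r`, the Lipschitz-like property of the epigraphs with modulus `ℓ`, and continuity of
`g` along the graph of its partial subdifferential up to the tolerance `ν`. -/
structure LocalData (g : X → P → EReal) (xb : X) (pb : P) (vh : X) (r ε ν ℓ γ : ℝ) : Prop where
  r_pos : 0 < r
  ε_pos : 0 < ε
  ν_pos : 0 < ν
  ℓ_pos : 0 < ℓ
  value : g xb pb = (γ : EReal)
  mem : vh ∈ pSubdiff g xb pb
  prox : ∀ x u p v (α : ℝ), ‖x - xb‖ < ε → ‖u - xb‖ < ε → dist p pb < ε → ‖v - vh‖ < ε →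
    v ∈ pSubdiff g u p → g x p ≤ (α : EReal) →
    (g u p).toReal + ⟪v, x - u⟫ - r / 2 * ‖x - u‖ ^ 2 ≤ α
  finite : ∀ u p v, ‖u - xb‖ < ε → dist p pb < ε → ‖v - vh‖ < ε → v ∈ pSubdiff g u p →
    g u p = ((g u p).toReal : EReal) ∧ |(g u p).toReal - γ| < ν
  epi_lip : ∀ p p' x (α : ℝ), ‖x - xb‖ < ε → |α - γ| < ν → dist p pb < ε → dist p' pb < ε →
    g x p ≤ (α : EReal) → ∃ x' α', g x' p' ≤ ((α' : ℝ) : EReal) ∧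
      ‖x - x'‖ ≤ ℓ * dist p p' ∧ |α - α'| ≤ ℓ * dist p p'
  lower : ∀ x p, ‖x - xb‖ < ε → dist p pb < ε → ((γ - ν : ℝ) : EReal) < g x p

theorem exists_localData {g : X → P → EReal} {xb vh : X} {pb : P} {r : ℝ}
    (hg_lsc : LowerSemicontinuous fun t : X × P => g t.1 t.2) (hg_proper : ∀ x p, g x p ≠ ⊥)
    (hvh : vh ∈ pSubdiff g xb pb) (hr : 0 < r) (hprox : ProxRegWith g xb pb vh r)
    (hcont : SubdiffCont g xb pb vh) (hA3 : A3 g xb pb) :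
    ∃ ε ν ℓ γ, LocalData g xb pb vh r ε ν ℓ γ := by
  obtain ⟨ε₁, hε₁, hprox⟩ := hprox
  have hfin : ∀ u p v, ‖u - xb‖ < ε₁ → dist p pb < ε₁ → ‖v - vh‖ < ε₁ → v ∈ pSubdiff g u p →
      g u p ≠ ⊤ := by
    intro u p v hu hp hv hmem
    refine ne_top_of_mem_limSubdiff (h := fun x' => g x' p) hmem ?_
    have : ∀ᶠ x in 𝓝 u, ‖x - xb‖ < ε₁ :=
      ((continuous_id.sub continuous_const).norm.tendsto u).eventually_lt_const hu
    exact this.mono fun x hx => ⟨_, hprox x u p v hx hu hp hv hmem⟩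
  have hγ : g xb pb = ((g xb pb).toReal : EReal) :=
    (EReal.coe_toReal (hfin xb pb vh (by simpa) (by simpa) (by simpa) hvh)
      (hg_proper _ _)).symm
  set γ := (g xb pb).toReal with hγdef
  obtain ⟨ℓ, hℓ, Un, hUn, Vn, hVn, hlip⟩ := hA3
  obtain ⟨ε₂, hε₂, hUsub⟩ := Metric.mem_nhds_iff.1 hUn
  obtain ⟨ν, hν, hVsub⟩ := Metric.mem_nhds_iff.1 hVn
  have hlow : ∀ᶠ t in 𝓝 (xb, pb), ((γ - ν : ℝ) : EReal) < g t.1 t.2 := by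
    refine hg_lsc (xb, pb) _ ?_
    simp only [hγ]
    exact EReal.coe_lt_coe_iff.2 (by linarith)
  obtain ⟨ε₃, hε₃, hlow⟩ := Metric.eventually_nhds_iff.1 hlow
  have hval : ∀ᶠ t in 𝓝[{t : X × P × X | t.2.2 ∈ pSubdiff g t.1 t.2.1}] (xb, pb, vh),
      ((γ - ν : ℝ) : EReal) < g t.1 t.2.1 ∧ g t.1 t.2.1 < ((γ + ν : ℝ) : EReal) := by
    have h := hcont
    unfold SubdiffCont at h
    rw [hγ] at h
    exact (h.eventually_const_lt (EReal.coe_lt_coe_iff.2 (by linarith))).and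
      (h.eventually_lt_const (EReal.coe_lt_coe_iff.2 (by linarith)))
  rw [eventually_nhdsWithin_iff] at hval
  obtain ⟨ε₄, hε₄, hval⟩ := Metric.eventually_nhds_iff.1 hval
  obtain ⟨ε, hε, h1, h2, h3, h4, h5⟩ :
      ∃ ε > 0, ε ≤ ε₁ ∧ ε ≤ ε₂ ∧ ε ≤ ε₃ ∧ ε ≤ ε₄ ∧ ε ≤ ν :=
    ⟨min ε₁ (min ε₂ (min ε₃ (min ε₄ ν))), by positivity, by simp, by simp, by simp, by simp,
      by simp⟩
  refine ⟨ε, ν, ℓ, γ, hr, hε, hν, hℓ, hγ, hvh, ?_, ?_, ?_, ?_⟩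
  · intro x u p v α hx hu hp hv hmem hα
    have hu' := EReal.coe_toReal (hfin u p v (hu.trans_le h1) (hp.trans_le h1) (hv.trans_le h1)
      hmem) (hg_proper _ _)
    have := (hprox x u p v (hx.trans_le h1) (hu.trans_le h1) (hp.trans_le h1) (hv.trans_le h1)
      hmem).trans hα
    rw [← hu', ← EReal.coe_add, EReal.coe_le_coe_iff] at this
    linarith
  · intro u p v hu hp hv hmem
    have hu' := EReal.coe_toReal (hfin u p v (hu.trans_le h1) (hp.trans_le h1) (hv.trans_le h1)
      hmem) (hg_proper _ _)
    refine ⟨hu'.symm, ?_⟩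
    have := hval (y := (u, p, v)) (by
      simp only [Prod.dist_eq, dist_eq_norm u, dist_eq_norm v]
      exact max_lt (hu.trans_le h4) (max_lt (hp.trans_le h4) (hv.trans_le h4))) hmem
    simp only at this
    rw [← hu', EReal.coe_lt_coe_iff, EReal.coe_lt_coe_iff] at this
    rw [abs_lt]
    constructor <;> linarith [this.1, this.2]
  · intro p p' x α hx hα hp hp' hle
    obtain ⟨⟨x', α'⟩, hz, hd⟩ := hlip p (hUsub (hp.trans_le h2)) p' (hUsub (hp'.trans_le h2)) (x, α)
      ⟨hle, hVsub (by
        rw [Metric.mem_ball, Prod.dist_eq, dist_eq_norm, Real.dist_eq]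
        exact max_lt (hx.trans_le h5) hα)⟩
    rw [Prod.mk_sub_mk, Prod.norm_def, max_le_iff] at hd
    exact ⟨x', α', hz, hd.1, hd.2⟩
  · intro x p hx hp
    exact hlow (y := (x, p)) (by
      rw [Prod.dist_eq, dist_eq_norm]
      exact max_lt (hx.trans_le h3) (hp.trans_le h3))

/-- Hypomonotonicity of the partial subdifferentials, up to an error of the order of the distance
between the parameters. -/
theorem LocalData.hypomonotone {g : X → P → EReal} {xb vh : X} {pb : P} {r ε ν ℓ γ : ℝ}
    (hd : LocalData g xb pb vh r ε ν ℓ γ) :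
    ∃ C > 0, ∃ δ > 0, δ ≤ ε ∧ ∀ x₁ x₂ p₁ p₂ s₁ s₂, ‖x₁ - xb‖ < δ → ‖x₂ - xb‖ < δ →
      dist p₁ pb < δ → dist p₂ pb < δ → ‖s₁ - vh‖ < δ → ‖s₂ - vh‖ < δ →
      s₁ ∈ pSubdiff g x₁ p₁ → s₂ ∈ pSubdiff g x₂ p₂ →
      -r * ‖x₁ - x₂‖ ^ 2 - C * dist p₁ p₂ ≤ ⟪s₁ - s₂, x₁ - x₂⟫ := by
  have hr := hd.r_pos
  have hε := hd.ε_pos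
  have hℓ := hd.ℓ_pos
  -- one half of the estimate
  have key : ∀ x₁ x₂ p₁ p₂ s₁ s₂, ‖x₁ - xb‖ < ε / 2 → ‖x₂ - xb‖ < ε / 2 →
      dist p₁ pb < ε → dist p₂ pb < ε → ‖s₁ - vh‖ < ε → ‖s₂ - vh‖ < ε →
      ℓ * dist p₁ p₂ < ε / 2 →
      s₁ ∈ pSubdiff g x₁ p₁ → s₂ ∈ pSubdiff g x₂ p₂ →
      (g x₂ p₂).toReal - (g x₁ p₁).toReal + ⟪s₂, x₁ - x₂⟫ - r / 2 * ‖x₁ - x₂‖ ^ 2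
        ≤ (1 + (‖vh‖ + ε) + 2 * r * ε) * (ℓ * dist p₁ p₂) := by
    intro x₁ x₂ p₁ p₂ s₁ s₂ hx₁ hx₂ hp₁ hp₂ hs₁ hs₂ hsmall hm₁ hm₂
    obtain ⟨hf₁, hν₁⟩ := hd.finite x₁ p₁ s₁ (by linarith) hp₁ hs₁ hm₁
    obtain ⟨x', α', hle, hx', hα'⟩ :=
      hd.epi_lip p₁ p₂ x₁ _ (by linarith) hν₁ hp₁ hp₂ hf₁.le
    set h := ℓ * dist p₁ p₂ with hh
    have hh0 : 0 ≤ h := by positivity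
    have hx'b : ‖x' - xb‖ < ε := by
      have := norm_sub_le_norm_sub_add_norm_sub x' x₁ xb
      rw [norm_sub_rev x' x₁] at this
      linarith
    have h1 := hd.prox x' x₂ p₂ s₂ α' hx'b (by linarith) hp₂ hs₂ hm₂ hle
    have h2 : ‖x' - x₂‖ ≤ ‖x₁ - x₂‖ + h := by
      have := norm_sub_le_norm_sub_add_norm_sub x' x₁ x₂
      rw [norm_sub_rev x' x₁] at this
      linarith
    have h3 : ‖x₁ - x₂‖ ≤ ε := by
      have := norm_sub_le_norm_sub_add_norm_sub x₁ xb x₂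
      rw [norm_sub_rev xb x₂] at this
      linarith
    have h4 : ‖x' - x₂‖ ^ 2 ≤ ‖x₁ - x₂‖ ^ 2 + 3 * ε * h := by
      have : ‖x' - x₂‖ ^ 2 ≤ (‖x₁ - x₂‖ + h) ^ 2 := by gcongr
      nlinarith [norm_nonneg (x₁ - x₂)]
    have h5 : ‖s₂‖ ≤ ‖vh‖ + ε := by
      have := norm_le_norm_add_norm_sub' s₂ vh
      linarith
    have h6 : ⟪s₂, x₁ - x₂⟫ ≤ ⟪s₂, x' - x₂⟫ + (‖vh‖ + ε) * h := by
      have e : ⟪s₂, x₁ - x₂⟫ = ⟪s₂, x' - x₂⟫ + ⟪s₂, x₁ - x'⟫ := by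
        rw [← inner_add_right]; congr 1; abel
      have : ⟪s₂, x₁ - x'⟫ ≤ (‖vh‖ + ε) * h :=
        (real_inner_le_norm _ _).trans (by gcongr)
      linarith
    have h7 := (abs_le.1 hα').1
    have h8 : r / 2 * ‖x' - x₂‖ ^ 2 ≤ r / 2 * (‖x₁ - x₂‖ ^ 2 + 3 * ε * h) := by gcongr
    have h9 : 0 ≤ r * ε * h := by positivity
    nlinarith
  refine ⟨2 * (1 + (‖vh‖ + ε) + 2 * r * ε) * ℓ, by positivity, min (ε / 2) (ε / (4 * ℓ)),
    by positivity, (min_le_left _ _).trans (by linarith), ?_⟩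
  intro x₁ x₂ p₁ p₂ s₁ s₂ hx₁ hx₂ hp₁ hp₂ hs₁ hs₂ hm₁ hm₂
  rw [lt_min_iff] at hx₁ hx₂ hp₁ hp₂ hs₁ hs₂
  have hdist : ℓ * dist p₁ p₂ < ε / 2 := by
    have h1 := dist_triangle_right p₁ p₂ pb
    have h2 : dist p₁ p₂ < ε / (2 * ℓ) := by
      have : ε / (2 * ℓ) = ε / (4 * ℓ) + ε / (4 * ℓ) := by field_simp; norm_num
      linarith [hp₁.2, hp₂.2]
    rw [lt_div_iff₀ (by positivity)] at h2
    linarith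
  have k1 := key x₁ x₂ p₁ p₂ s₁ s₂ hx₁.1 hx₂.1 (by linarith) (by linarith) (by linarith)
    (by linarith) hdist hm₁ hm₂
  have k2 := key x₂ x₁ p₂ p₁ s₂ s₁ hx₂.1 hx₁.1 (by linarith) (by linarith) (by linarith)
    (by linarith) (by rwa [dist_comm]) hm₂ hm₁
  rw [dist_comm p₂ p₁, norm_sub_rev x₂ x₁, ← neg_sub x₁ x₂, inner_neg_right] at k2
  rw [inner_sub_left]
  linarith

theorem mem_regSubdiff_of_quadratic_support {h : X → EReal} {x w : X} {G c M : ℝ}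
    (hx : h x = (G : EReal)) (hG : G < c)
    (hsupp : ∀ᶠ u in 𝓝 x, h u ≤ (c : EReal) →
      ((G + ⟪w, u - x⟫ - M * ‖u - x‖ ^ 2 : ℝ) : EReal) ≤ h u) :
    w ∈ regSubdiff h x := by
  refine ⟨by rw [hx]; exact EReal.coe_ne_top _, by rw [hx]; exact EReal.coe_ne_bot _,
    fun κ hκ => ?_⟩
  have hval : ∀ᶠ u in 𝓝 x, G + (⟪w, u - x⟫ - κ * ‖u - x‖) < c := by
    have hc : Continuous fun u => G + (⟪w, u - x⟫ - κ * ‖u - x‖) := by fun_prop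
    exact Tendsto.eventually_lt_const (by simpa using hG) (hc.tendsto x)
  have hquad : ∀ᶠ u in 𝓝 x, M * ‖u - x‖ < κ := by
    have hc : Continuous fun u => M * ‖u - x‖ := by fun_prop
    exact Tendsto.eventually_lt_const (by simpa using hκ) (hc.tendsto x)
  filter_upwards [hsupp, hval, hquad] with u hu1 hu2 hu3
  rw [hx, ← EReal.coe_add]
  by_cases hug : h u ≤ (c : EReal)
  · refine (EReal.coe_le_coe_iff.2 ?_).trans (hu1 hug)
    have : M * ‖u - x‖ * ‖u - x‖ ≤ κ * ‖u - x‖ := by gcongr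
    linarith
  · exact (EReal.coe_le_coe_iff.2 hu2.le).trans (not_le.1 hug).le

/-- Perturbed quadratic lower bound of `g` around the reference point. -/
theorem LocalData.quadratic_growth {g : X → P → EReal} {xb vh : X}
    {pb : P} {r ε ν ℓ γ : ℝ} (hd : LocalData g xb pb vh r ε ν ℓ γ) {x : X} {p : P} {G : ℝ}
    (hG : g x p = (G : EReal)) (hGγ : |G - γ| < ν) (hx1 : ‖x - xb‖ ≤ 1)
    (hx : ‖x - xb‖ < ε / 2) (hp : dist p pb < ε) (hp' : ℓ * dist p pb < ε / 2)
    (hp1 : ℓ * dist p pb ≤ 1) :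
    γ + ⟪vh, x - xb⟫ - r / 2 * (‖x - xb‖ ^ 2 + 3 * (ℓ * dist p pb))
      - (1 + ‖vh‖) * (ℓ * dist p pb) ≤ G := by
  have hr := hd.r_pos
  have hε := hd.ε_pos
  have hℓ := hd.ℓ_pos
  obtain ⟨x₂, α₂, hle₂, hx₂, hα₂⟩ := hd.epi_lip p pb x G (by linarith) hGγ hp (by simpa) hG.le
  set h := ℓ * dist p pb with hh
  have hh0 : 0 ≤ h := by positivity
  rw [norm_sub_rev] at hx₂
  have hx₂b : ‖x₂ - xb‖ ≤ ‖x - xb‖ + h := by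
    have := norm_sub_le_norm_sub_add_norm_sub x₂ x xb
    linarith
  have h1 := hd.prox x₂ xb pb vh α₂ (by linarith) (by simpa) (by simpa) (by simpa) hd.mem hle₂
  rw [hd.value, EReal.toReal_coe] at h1
  have h2 := (abs_le.1 hα₂).1
  have h3 : ⟪vh, x - xb⟫ ≤ ⟪vh, x₂ - xb⟫ + ‖vh‖ * h := by
    have e : ⟪vh, x - xb⟫ = ⟪vh, x₂ - xb⟫ + ⟪vh, x - x₂⟫ := by
      rw [← inner_add_right]; congr 1; abel
    have : ⟪vh, x - x₂⟫ ≤ ‖vh‖ * h := (real_inner_le_norm _ _).trans (by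
      gcongr; rwa [norm_sub_rev])
    linarith
  have h5 : r / 2 * ‖x₂ - xb‖ ^ 2 ≤ r / 2 * (‖x - xb‖ ^ 2 + 3 * h) := by
    gcongr
    calc ‖x₂ - xb‖ ^ 2 ≤ (‖x - xb‖ + h) ^ 2 := by gcongr
      _ ≤ ‖x - xb‖ ^ 2 + 3 * h := by nlinarith [norm_nonneg (x - xb)]
  linarith

set_option maxHeartbeats 1000000 in
/-- Solvability of the regularized subgradient inclusion up to an arbitrarily small error. -/
theorem LocalData.exists_approx_resolvent [CompleteSpace X] {g : X → P → EReal} {xb vh : X}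
    {pb : P} {r ε ν ℓ γ : ℝ} (hd : LocalData g xb pb vh r ε ν ℓ γ)
    (hg_lsc : ∀ p, LowerSemicontinuous fun x => g x p)
    {s : ℝ} (hs : r < s) {ρ : ℝ} (hρ : 0 < ρ) :
    ∃ η > 0, ∀ p ζ τ, dist p pb < η → ‖ζ‖ < η → 0 < τ → τ ≤ η →
      ∃ x e : X, ‖x - xb‖ < ρ ∧ ‖e‖ ≤ τ ∧
        vh + ζ + e - s • (x - xb) ∈ regSubdiff (fun x => g x p) x := by
  have hr := hd.r_pos
  have hε := hd.ε_pos
  have hν := hd.ν_pos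
  have hℓ := hd.ℓ_pos
  have hs0 : 0 < s := hr.trans hs
  have hsr : 0 < s - r := sub_pos.2 hs
  obtain ⟨δ, hδ, hδρ, hδε, hδν, hδ1⟩ : ∃ δ > 0, δ ≤ ρ ∧ δ ≤ ε / 4 ∧
      (‖vh‖ + 1) * δ ≤ ν / 8 ∧ δ ≤ 1 := by
    refine ⟨min ρ (min (ε / 4) (min (ν / 8 / (‖vh‖ + 1)) 1)), by positivity, by simp, by simp,
      ?_, by simp⟩
    have : min ρ (min (ε / 4) (min (ν / 8 / (‖vh‖ + 1)) 1)) ≤ ν / 8 / (‖vh‖ + 1) := by simp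
    rwa [le_div_iff₀ (by positivity), mul_comm] at this
  obtain ⟨K, hK⟩ : ∃ K, K = (3 + 2 * ‖vh‖ + 2 * r + s) * ℓ + 7 := ⟨_, rfl⟩
  have hK0 : 0 < K := by rw [hK]; positivity
  obtain ⟨η, hη, hη1, hηδ, hην, hηs, hηK, hηε⟩ : ∃ η > 0, η ≤ 1 ∧ ℓ * η ≤ δ ∧ ℓ * η < ν / 2 ∧
      K * η < (s - r) / 2 * δ ^ 2 ∧ K * η ≤ ν / 8 ∧ η ≤ ε := by
    refine ⟨min 1 (min (δ / ℓ) (min (ν / 4 / ℓ) (min ((s - r) / 4 * δ ^ 2 / K)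
      (min (ν / 8 / K) ε)))), by positivity, by simp, ?_, ?_, ?_, ?_, by simp⟩
    all_goals set η := min 1 (min (δ / ℓ) (min (ν / 4 / ℓ) (min ((s - r) / 4 * δ ^ 2 / K)
      (min (ν / 8 / K) ε)))) with hη
    · have : η ≤ δ / ℓ := by simp [hη]
      rwa [le_div_iff₀ hℓ, mul_comm] at this
    · have : η ≤ ν / 4 / ℓ := by simp [hη]
      rw [le_div_iff₀ hℓ, mul_comm] at this
      linarith
    · have : η ≤ (s - r) / 4 * δ ^ 2 / K := by simp [hη]
      rw [le_div_iff₀ hK0, mul_comm] at this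
      have : 0 < (s - r) * δ ^ 2 := by positivity
      linarith
    · have : η ≤ ν / 8 / K := by simp [hη]
      rwa [le_div_iff₀ hK0, mul_comm] at this
  refine ⟨η, hη, fun p ζ τ hp hζ hτ hτη => ?_⟩
  obtain ⟨h, hh⟩ : ∃ h, h = ℓ * dist p pb := ⟨_, rfl⟩
  have hh0 : 0 ≤ h := by rw [hh]; positivity
  have hhη : h ≤ ℓ * η := by rw [hh]; gcongr
  set D : Set X := {x | ‖x - xb‖ ≤ δ ∧ g x p ≤ ((γ + ν / 2 : ℝ) : EReal)} with hDdef
  have hfin : ∀ x ∈ D, g x p = ((g x p).toReal : EReal) ∧ γ - ν < (g x p).toReal ∧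
      (g x p).toReal ≤ γ + ν / 2 := by
    rintro x ⟨hx, hgx⟩
    have hlow := hd.lower x p (by linarith) (by linarith)
    have e : g x p = ((g x p).toReal : EReal) :=
      (EReal.coe_toReal (ne_top_of_le_ne_top (EReal.coe_ne_top _) hgx)
        (ne_bot_of_gt hlow)).symm
    rw [e, EReal.coe_lt_coe_iff] at hlow
    rw [e, EReal.coe_le_coe_iff] at hgx
    exact ⟨e, hlow, hgx⟩
  have hDc : IsClosed D :=
    (isClosed_le (continuous_id.sub continuous_const).norm continuous_const).inter
      ((hg_lsc p).isClosed_preimage ((γ + ν / 2 : ℝ) : EReal))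
  -- a point of `D` whose value is almost `γ`
  obtain ⟨x', α', hx'le, hx', hα'⟩ := hd.epi_lip pb p xb γ (by simpa) (by simpa) (by simpa)
    (by linarith) hd.value.le
  rw [dist_comm, ← hh] at hx' hα'
  rw [norm_sub_rev] at hx'
  have hα'1 : α' ≤ γ + h := by linarith [(abs_le.1 hα').1]
  have hx'D : x' ∈ D := ⟨by linarith, hx'le.trans (EReal.coe_le_coe_iff.2 (by linarith))⟩
  have hx'g : (g x' p).toReal ≤ γ + h := by
    rw [(hfin x' hx'D).1, EReal.coe_le_coe_iff] at hx'le
    linarith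
  set F : X → ℝ := fun u => (g u p).toReal + (s / 2 * ‖u - xb‖ ^ 2 - ⟪vh + ζ, u - xb⟫) with hF
  have hFl : LowerSemicontinuousOn F D := by
    refine LowerSemicontinuousOn.add ?_ (Continuous.continuousOn (by fun_prop)).lowerSemicontinuousOn
    intro x hx y hy
    have hy' : (y : EReal) < g x p := by
      rw [(hfin x hx).1]; exact EReal.coe_lt_coe_iff.2 hy
    filter_upwards [((hg_lsc p) x _ hy').filter_mono nhdsWithin_le_nhds, self_mem_nhdsWithin]
      with z hz hzD
    rw [(hfin z hzD).1] at hz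
    exact EReal.coe_lt_coe_iff.1 hz
  have hlin : ∀ u, ‖u - xb‖ ≤ δ → ⟪vh + ζ, u - xb⟫ ≤ (‖vh‖ + 1) * ‖u - xb‖ := fun u hu =>
    (real_inner_le_norm _ _).trans (by
      gcongr
      exact (norm_add_le _ _).trans (by linarith))
  have hFb : BddBelow (F '' D) := by
    refine ⟨γ - ν - (‖vh‖ + 1) * δ, ?_⟩
    rintro _ ⟨u, hu, rfl⟩
    have h1 := hlin u hu.1
    have h2 : (‖vh‖ + 1) * ‖u - xb‖ ≤ (‖vh‖ + 1) * δ := by gcongr; exact hu.1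
    have h3 : 0 ≤ s / 2 * ‖u - xb‖ ^ 2 := by positivity
    have h4 := (hfin u hu).2.1
    simp only [hF]
    linarith
  have hdiam : ∀ x ∈ D, ∀ y ∈ D, ‖x - y‖ ≤ 2 * δ := fun x hx y hy => by
    have := norm_sub_le_norm_sub_add_norm_sub x xb y
    rw [norm_sub_rev xb y] at this
    linarith [hx.1, hy.1]
  obtain ⟨x, hxD, e, M, hM0, hMτ, heτ, hmin⟩ :=
    exists_quadratic_support hDc ⟨x', hx'D⟩ hdiam hFl hFb hτ
  obtain ⟨hxf, hxl, hxu⟩ := hfin x hxD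
  obtain ⟨G, hG⟩ : ∃ G, G = (g x p).toReal := ⟨_, rfl⟩
  rw [← hG] at hxf hxl hxu
  obtain ⟨t, ht⟩ : ∃ t, t = ‖x - xb‖ := ⟨_, rfl⟩
  have ht0 : 0 ≤ t := by rw [ht]; positivity
  have htδ : t ≤ δ := by rw [ht]; exact hxD.1
  have hh1 : h ≤ 1 := by linarith
  have hFx : F x ≤ γ + (2 + ‖vh‖ + s) * h + 6 * τ := by
    have h1 := hmin x' hx'D
    have h2 : F x' ≤ γ + h + s / 2 * h ^ 2 + (‖vh‖ + 1) * h := by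
      have h21 : s / 2 * ‖x' - xb‖ ^ 2 ≤ s / 2 * h ^ 2 := by gcongr
      have h22 : -⟪vh + ζ, x' - xb⟫ ≤ (‖vh‖ + 1) * h := by
        have := (abs_le.1 (abs_real_inner_le_norm (vh + ζ) (x' - xb))).1
        have h23 : ‖vh + ζ‖ * ‖x' - xb‖ ≤ (‖vh‖ + 1) * h := by
          gcongr
          exact (norm_add_le _ _).trans (by linarith)
        linarith
      simp only [hF]
      linarith
    have hdx := hdiam x' hx'D x hxD
    have h3 : -⟪e, x' - x⟫ ≤ 2 * τ := by
      have := (abs_le.1 (abs_real_inner_le_norm e (x' - x))).1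
      have h31 : ‖e‖ * ‖x' - x‖ ≤ τ * 2 := by gcongr; linarith
      linarith
    have h4 : M * ‖x' - x‖ ^ 2 ≤ τ * 2 ^ 2 := by gcongr; linarith
    have h5 : s / 2 * h ^ 2 ≤ s * h := by nlinarith [mul_nonneg hs0.le hh0]
    linarith
  have hFx' : F x ≤ γ + K * η := by
    have h1 : (2 + ‖vh‖ + s) * h ≤ (2 + ‖vh‖ + s) * (ℓ * η) := by gcongr
    have h2 : 0 ≤ (1 + ‖vh‖ + 2 * r) * (ℓ * η) := by positivity
    rw [hK]
    linarith
  have hFG : F x = G + (s / 2 * t ^ 2 - ⟪vh + ζ, x - xb⟫) := by simp only [hF, hG, ht]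
  have hGlt : G < γ + ν / 2 := by
    have h1 := hlin x hxD.1
    have h2 : (‖vh‖ + 1) * ‖x - xb‖ ≤ (‖vh‖ + 1) * δ := by gcongr; exact hxD.1
    have h3 : 0 ≤ s / 2 * t ^ 2 := by positivity
    linarith
  have htlt : t < δ := by
    have h5 := hd.quadratic_growth hxf (abs_lt.2 ⟨by linarith, by linarith⟩) (by linarith)
      (by linarith) (by linarith) (by linarith) (by linarith)
    rw [← hh, ← ht] at h5
    have h4 : ⟪ζ, x - xb⟫ ≤ η := by
      calc ⟪ζ, x - xb⟫ ≤ ‖ζ‖ * ‖x - xb‖ := real_inner_le_norm _ _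
        _ ≤ η * 1 := by gcongr; linarith
        _ = η := mul_one _
    rw [inner_add_left] at hFG
    have h6 : (s - r) / 2 * t ^ 2 ≤ K * η := by
      have h7 : (3 + 2 * ‖vh‖ + 2 * r + s) * h ≤ (3 + 2 * ‖vh‖ + 2 * r + s) * (ℓ * η) := by gcongr
      have h8 : 0 ≤ r * h := by positivity
      rw [hK]
      linarith
    have h7 : (s - r) / 2 * t ^ 2 < (s - r) / 2 * δ ^ 2 := h6.trans_lt hηs
    exact lt_of_pow_lt_pow_left₀ 2 hδ.le (lt_of_mul_lt_mul_left h7 (by positivity))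
  have hnhds : ∀ᶠ u in 𝓝 x, ‖u - xb‖ < δ :=
    Tendsto.eventually_lt_const (by rwa [ht] at htlt)
      ((continuous_id.sub continuous_const).norm.tendsto x)
  refine ⟨x, e, by linarith, heτ, mem_regSubdiff_of_quadratic_support (M := M + s / 2) hxf hGlt
    (hnhds.mono fun u hu hug => ?_)⟩
  have huD : u ∈ D := ⟨hu.le, hug⟩
  rw [(hfin u huD).1, EReal.coe_le_coe_iff]
  have h1 := hmin u huD
  have h2 : ‖u - xb‖ ^ 2 = ‖u - x‖ ^ 2 + 2 * ⟪x - xb, u - x⟫ + t ^ 2 := by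
    rw [ht, ← real_inner_comm, ← norm_add_sq_real]; congr 2; abel
  have h3 : ⟪vh + ζ, u - xb⟫ = ⟪vh + ζ, u - x⟫ + ⟪vh + ζ, x - xb⟫ := by
    rw [← inner_add_right]; congr 1; abel
  rw [hFG] at h1
  simp only [hF, h2, h3] at h1
  rw [inner_sub_left, inner_add_left, real_inner_smul_left]
  linarith

/-- Solvability of the regularized subgradient inclusion. -/
theorem LocalData.exists_resolvent [CompleteSpace X] {g : X → P → EReal} {xb vh : X}
    {pb : P} {r ε ν ℓ γ : ℝ} (hd : LocalData g xb pb vh r ε ν ℓ γ)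
    (hg_lsc : ∀ p, LowerSemicontinuous fun x => g x p)
    {s : ℝ} (hs : r < s) {ρ : ℝ} (hρ : 0 < ρ) :
    ∃ η > 0, ∀ p ζ, dist p pb < η → ‖ζ‖ < η →
      ∃ x : X, ‖x - xb‖ < ρ ∧ vh + ζ - s • (x - xb) ∈ pSubdiff g x p := by
  have hs0 : 0 < s := hd.r_pos.trans hs
  have hsr : 0 < s - r := sub_pos.2 hs
  obtain ⟨C, -, δ, hδ, hδε, hhyp⟩ := hd.hypomonotone
  obtain ⟨ρ', hρ', hρ'ρ, hρ'δ, hρ's⟩ : ∃ ρ' > 0, ρ' < ρ ∧ ρ' < δ ∧ s * ρ' ≤ δ / 4 := by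
    refine ⟨min (ρ / 2) (min (δ / 2) (δ / 4 / s)), by positivity,
      (min_le_left _ _).trans_lt (by linarith),
      ((min_le_right _ _).trans (min_le_left _ _)).trans_lt (by linarith), ?_⟩
    have : min (ρ / 2) (min (δ / 2) (δ / 4 / s)) ≤ δ / 4 / s := by simp
    rwa [le_div_iff₀ hs0, mul_comm] at this
  obtain ⟨η₀, hη₀, hex⟩ := hd.exists_approx_resolvent hg_lsc hs hρ'
  refine ⟨min η₀ (δ / 4), by positivity, fun p ζ hp hζ => ?_⟩
  set η := min η₀ (δ / 4) with hη
  have hη0 : 0 < η := by positivity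
  have hηη₀ : η ≤ η₀ := min_le_left _ _
  have hηδ : η ≤ δ / 4 := min_le_right _ _
  have hex' := fun n : ℕ => hex p ζ (η * (1 / 2 : ℝ) ^ n) (hp.trans_le hηη₀) (hζ.trans_le hηη₀)
    (by positivity) ((mul_le_of_le_one_right hη0.le
      (pow_le_one₀ (by norm_num) (by norm_num))).trans hηη₀)
  choose xs es hxs hes hreg using hex'
  set vs : ℕ → X := fun n => vh + ζ + es n - s • (xs n - xb) with hvs
  have hesη : ∀ n, ‖es n‖ ≤ η := fun n => (hes n).trans (mul_le_of_le_one_right hη0.le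
    (pow_le_one₀ (by norm_num) (by norm_num)))
  have hmem : ∀ n, vs n ∈ pSubdiff g (xs n) p := fun n =>
    regSubdiff_subset_limSubdiff _ _ (hreg n)
  have hvδ : ∀ n, ‖vs n - vh‖ < δ := fun n => by
    have e1 : vs n - vh = ζ + es n - s • (xs n - xb) := by simp only [hvs]; abel
    have h1 : ‖s • (xs n - xb)‖ ≤ δ / 4 := by
      rw [norm_smul, Real.norm_of_nonneg hs0.le]
      exact (mul_le_mul_of_nonneg_left (hxs n).le hs0.le).trans hρ's
    rw [e1]
    have h2 := norm_sub_le (ζ + es n) (s • (xs n - xb))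
    have h3 := norm_add_le ζ (es n)
    linarith [hesη n]
  have hpδ : dist p pb < δ := by linarith
  have hcauchy : CauchySeq xs := by
    refine cauchySeq_of_le_geometric (1 / 2) (2 * η / (s - r)) (by norm_num) fun n => ?_
    have h1 := hhyp (xs n) (xs (n + 1)) p p (vs n) (vs (n + 1)) ((hxs _).trans hρ'δ)
      ((hxs _).trans hρ'δ) hpδ hpδ (hvδ _) (hvδ _) (hmem _) (hmem _)
    have e1 : vs n - vs (n + 1) = (es n - es (n + 1)) - s • (xs n - xs (n + 1)) := by
      simp only [hvs]; module
    rw [e1, inner_sub_left, real_inner_smul_left, real_inner_self_eq_norm_sq, dist_self] at h1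
    have h2 := real_inner_le_norm (es n - es (n + 1)) (xs n - xs (n + 1))
    have h3 : ‖es n - es (n + 1)‖ ≤ 2 * η * (1 / 2 : ℝ) ^ n := by
      have := norm_sub_le (es n) (es (n + 1))
      have h4 := hes n
      have h5 := hes (n + 1)
      rw [pow_succ] at h5
      have h6 : 0 < η * (1 / 2 : ℝ) ^ n := by positivity
      linarith
    rw [dist_eq_norm, div_mul_eq_mul_div, le_div_iff₀ hsr]
    rcases (norm_nonneg (xs n - xs (n + 1))).eq_or_lt with h0 | h0
    · rw [← h0]; simp; positivity
    · refine le_of_mul_le_mul_right ?_ h0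
      have h4 : ‖es n - es (n + 1)‖ * ‖xs n - xs (n + 1)‖
          ≤ 2 * η * (1 / 2 : ℝ) ^ n * ‖xs n - xs (n + 1)‖ := by gcongr
      linarith
  obtain ⟨x, hx⟩ := cauchySeq_tendsto_of_complete hcauchy
  have hxb : ‖x - xb‖ ≤ ρ' :=
    le_of_tendsto (hx.sub_const xb).norm (Eventually.of_forall fun n => (hxs n).le)
  have hes0 : Tendsto es atTop (𝓝 0) := by
    refine squeeze_zero_norm hes ?_
    have := (tendsto_pow_atTop_nhds_zero_of_lt_one (r := (1 / 2 : ℝ)) (by norm_num)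
      (by norm_num)).const_mul η
    rwa [mul_zero] at this
  have hvt : Tendsto vs atTop (𝓝 (vh + ζ - s • (x - xb))) := by
    have := (hes0.const_add (vh + ζ)).sub ((hx.sub_const xb).const_smul s)
    rwa [add_zero] at this
  refine ⟨x, hxb.trans_lt hρ'ρ, xs, vs, hx, ?_, hreg, fun z => hvt.inner tendsto_const_nhds⟩
  refine tendsto_order.2 ⟨fun y hy => hx.eventually (hg_lsc p x y hy), fun y hy => ?_⟩
  have hlow := hd.lower x p (by linarith) (by linarith)
  have hα := EReal.coe_toReal (ne_top_of_lt hy) (ne_bot_of_gt hlow)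
  set α := (g x p).toReal
  have hle : ∀ n, g (xs n) p ≤ ((α - ⟪vs n, x - xs n⟫ + r / 2 * ‖x - xs n‖ ^ 2 : ℝ) : EReal) := by
    intro n
    have h1 := hd.prox x (xs n) p (vs n) α (by linarith) (by linarith [hxs n]) (by linarith)
      ((hvδ n).trans_le hδε) (hmem n) hα.ge
    rw [(hd.finite (xs n) p (vs n) (by linarith [hxs n]) (by linarith)
      ((hvδ n).trans_le hδε) (hmem n)).1, EReal.coe_le_coe_iff]
    linarith
  have hlim : Tendsto (fun n => α - ⟪vs n, x - xs n⟫ + r / 2 * ‖x - xs n‖ ^ 2) atTop (𝓝 α) := by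
    have h1 := hx.const_sub x
    have h2 := ((hvt.inner h1).const_sub α).add ((h1.norm.pow 2).const_mul (r / 2))
    simpa using h2
  have hlim' := (continuous_coe_real_ereal.tendsto α).comp hlim
  exact (hlim'.eventually_lt_const (by rwa [hα])).mono fun n hn => (hle n).trans_lt hn

/-- Strong monotonicity of the solution map, up to an error in the parameters that is linear in
the first parameter and of product type in the second one. -/
theorem LocalData.solMap_strong_monotone {f : X → P → Q → X} {g : X → P → EReal} {xb vb vh : X}
    {pb : P} {qb : Q} {r ε ν ℓ γ σ : ℝ} (hd : LocalData g xb pb vh r ε ν ℓ γ)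
    (hvh : vh = vb - f xb pb qb) (hA1 : A1 f xb pb qb) (hmono : StrongMono f xb pb qb σ) :
    ∃ C > 0, ∃ L > 0, ∃ δ > 0, ∀ v₁ v₂ p₁ p₂ q₁ q₂ x₁ x₂, ‖v₁ - vb‖ < δ → ‖v₂ - vb‖ < δ →
      dist p₁ pb < δ → dist p₂ pb < δ → dist q₁ qb < δ → dist q₂ qb < δ →
      ‖x₁ - xb‖ < δ → ‖x₂ - xb‖ < δ → x₁ ∈ SolMap f g v₁ p₁ q₁ → x₂ ∈ SolMap f g v₂ p₂ q₂ →
      (σ - r) * ‖x₁ - x₂‖ ^ 2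
        ≤ ⟪v₁ - v₂, x₁ - x₂⟫ + C * dist p₁ p₂ + L * dist q₁ q₂ * ‖x₁ - x₂‖ := by
  obtain ⟨C, hC, δ₀, hδ₀, -, hhyp⟩ := hd.hypomonotone
  obtain ⟨L, hL, ε₁, hε₁, hlip⟩ := hA1
  obtain ⟨ε₂, hε₂, hmono⟩ := hmono
  obtain ⟨δ, hδ, h0, h1, h2, h3⟩ :
      ∃ δ > 0, δ ≤ δ₀ ∧ δ ≤ ε₁ ∧ δ ≤ ε₂ ∧ (1 + 3 * L) * δ ≤ δ₀ := by
    refine ⟨min δ₀ (min ε₁ (min ε₂ (δ₀ / (1 + 3 * L)))), by positivity, by simp, by simp,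
      by simp, ?_⟩
    have : min δ₀ (min ε₁ (min ε₂ (δ₀ / (1 + 3 * L)))) ≤ δ₀ / (1 + 3 * L) := by simp
    rwa [le_div_iff₀ (by positivity), mul_comm] at this
  have hsub : ∀ v p q x, ‖v - vb‖ < δ → dist p pb < δ → dist q qb < δ → ‖x - xb‖ < δ →
      ‖v - f x p q - vh‖ < δ₀ := by
    intro v p q x hv hp hq hx
    have e : v - f x p q - vh = (v - vb) - (f x p q - f xb pb qb) := by rw [hvh]; abel
    have l1 := hlip x xb p pb q qb (by linarith) (by simpa) (by linarith) (by simpa)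
      (by linarith) (by simpa)
    have l2 : L * (‖x - xb‖ + dist p pb + dist q qb) ≤ L * (δ + δ + δ) := by gcongr
    rw [e]
    have := norm_sub_le (v - vb) (f x p q - f xb pb qb)
    linarith
  refine ⟨C + L * (2 * δ), by positivity, L, hL, δ, hδ, ?_⟩
  intro v₁ v₂ p₁ p₂ q₁ q₂ x₁ x₂ hv₁ hv₂ hp₁ hp₂ hq₁ hq₂ hx₁ hx₂ hs₁ hs₂
  have m1 := hhyp x₁ x₂ p₁ p₂ _ _ (hx₁.trans_le h0) (hx₂.trans_le h0) (hp₁.trans_le h0)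
    (hp₂.trans_le h0) (hsub v₁ p₁ q₁ x₁ hv₁ hp₁ hq₁ hx₁) (hsub v₂ p₂ q₂ x₂ hv₂ hp₂ hq₂ hx₂) hs₁ hs₂
  have m2 := hmono x₁ x₂ p₁ q₁ (hx₁.trans_le h2) (hx₂.trans_le h2) (hp₁.trans_le h2)
    (hq₁.trans_le h2)
  have m3 := hlip x₂ x₂ p₁ p₂ q₁ q₂ (hx₂.trans_le h1) (hx₂.trans_le h1) (hp₁.trans_le h1)
    (hp₂.trans_le h1) (hq₁.trans_le h1) (hq₂.trans_le h1)
  rw [sub_self, norm_zero, zero_add] at m3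
  have e : v₁ - f x₁ p₁ q₁ - (v₂ - f x₂ p₂ q₂) = (v₁ - v₂) - (f x₁ p₁ q₁ - f x₂ p₁ q₁)
      - (f x₂ p₁ q₁ - f x₂ p₂ q₂) := by abel
  rw [e, inner_sub_left, inner_sub_left _ (f x₁ p₁ q₁ - f x₂ p₁ q₁)] at m1
  have m4 := (abs_le.1 (abs_real_inner_le_norm (f x₂ p₁ q₁ - f x₂ p₂ q₂) (x₁ - x₂))).1
  have m5 : ‖f x₂ p₁ q₁ - f x₂ p₂ q₂‖ * ‖x₁ - x₂‖
      ≤ L * (dist p₁ p₂ + dist q₁ q₂) * ‖x₁ - x₂‖ := by gcongr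
  have m6 : ‖x₁ - x₂‖ ≤ 2 * δ := by
    have := norm_sub_le_norm_sub_add_norm_sub x₁ xb x₂
    rw [norm_sub_rev xb x₂] at this
    linarith
  have m7 : L * dist p₁ p₂ * ‖x₁ - x₂‖ ≤ L * dist p₁ p₂ * (2 * δ) := by gcongr
  linarith

/-- Local solvability of the parametric variational system, by a contraction argument applied to
the composition of the localized resolvent of the subdifferential with a forward step. -/
theorem LocalData.exists_solution [CompleteSpace X] {f : X → P → Q → X} {g : X → P → EReal}
    {xb vb vh : X} {pb : P} {qb : Q} {r ε ν ℓ γ σ : ℝ} (hd : LocalData g xb pb vh r ε ν ℓ γ)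
    (hg_lsc : ∀ p, LowerSemicontinuous fun x => g x p)
    (hvh : vh = vb - f xb pb qb) (hA1 : A1 f xb pb qb) (hmono : StrongMono f xb pb qb σ)
    (hσ : r < σ) {ρ : ℝ} (hρ : 0 < ρ) :
    ∃ η > 0, ∀ v p q, ‖v - vb‖ < η → dist p pb < η → dist q qb < η →
      ∃ x, ‖x - xb‖ < ρ ∧ x ∈ SolMap f g v p q := by
  have hr := hd.r_pos
  have hσr : 0 < σ - r := sub_pos.2 hσ
  obtain ⟨C, -, δ, hδ, -, hhyp⟩ := hd.hypomonotone
  obtain ⟨L, hL, ε₁, hε₁, hlip⟩ := hA1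
  obtain ⟨ε₂, hε₂, hmono⟩ := hmono
  obtain ⟨s, hs, hsL⟩ : ∃ s, r < s ∧ s ^ 2 - 2 * s * σ + L ^ 2 < (s - r) ^ 2 := by
    refine ⟨r + L ^ 2 / (2 * (σ - r)) + 1, by have : 0 < L ^ 2 / (2 * (σ - r)) := by positivity
                                              linarith, ?_⟩
    have e : L ^ 2 / (2 * (σ - r)) * (2 * (σ - r)) = L ^ 2 := by field_simp
    nlinarith
  have hs0 : 0 < s := hr.trans hs
  have hsr : 0 < s - r := sub_pos.2 hs
  set θ : ℝ := √(s ^ 2 - 2 * s * σ + L ^ 2) / (s - r) with hθ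
  have hθ0 : 0 ≤ θ := by positivity
  have hθ1 : θ < 1 := by
    rw [hθ, div_lt_one hsr]
    exact (Real.sqrt_lt' hsr).2 hsL
  have hθs : θ * (s - r) = √(s ^ 2 - 2 * s * σ + L ^ 2) := div_mul_cancel₀ _ hsr.ne'
  obtain ⟨ρa, hρa, hρaδ, hρas⟩ : ∃ ρa > 0, ρa ≤ δ ∧ s * ρa ≤ δ / 2 := by
    refine ⟨min δ (δ / 2 / s), by positivity, by simp, ?_⟩
    have : min δ (δ / 2 / s) ≤ δ / 2 / s := by simp
    rwa [le_div_iff₀ hs0, mul_comm] at this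
  obtain ⟨ηa, hηa, hresa⟩ := hd.exists_resolvent hg_lsc hs hρa
  obtain ⟨μ, hμ, hμa, hμδ⟩ : ∃ μ > 0, μ ≤ ηa ∧ μ ≤ δ / 2 :=
    ⟨min ηa (δ / 2), by positivity, by simp, by simp⟩
  obtain ⟨ρ₁, hρ₁, hρ₁ρ, hρ₁1, hρ₁2, hρ₁μ⟩ :
      ∃ ρ₁ > 0, ρ₁ < ρ ∧ ρ₁ < ε₁ ∧ ρ₁ < ε₂ ∧ (L + s) * ρ₁ ≤ μ / 2 := by
    refine ⟨min (min ρ (min ε₁ ε₂) / 2) (μ / 2 / (L + s)), by positivity, ?_, ?_, ?_, ?_⟩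
    · have : min ρ (min ε₁ ε₂) ≤ ρ := by simp
      exact (min_le_left _ _).trans_lt (by linarith)
    · have : min ρ (min ε₁ ε₂) ≤ ε₁ := by simp
      exact (min_le_left _ _).trans_lt (by linarith)
    · have : min ρ (min ε₁ ε₂) ≤ ε₂ := by simp
      exact (min_le_left _ _).trans_lt (by linarith)
    · have := min_le_right (min ρ (min ε₁ ε₂) / 2) (μ / 2 / (L + s))
      rwa [le_div_iff₀ (by positivity), mul_comm] at this
  have hθρ : 0 < (1 - θ) * ρ₁ := mul_pos (by linarith) hρ₁
  obtain ⟨ηb, hηb, hresb⟩ := hd.exists_resolvent hg_lsc hs (lt_min hρa hθρ)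
  obtain ⟨η, hη, hη1, hη2, hηδ, hηa', hηb', hημ, hηηb⟩ : ∃ η > 0, η ≤ ε₁ ∧ η ≤ ε₂ ∧ η ≤ δ ∧
      η ≤ ηa ∧ η ≤ ηb ∧ (1 + 2 * L) * η ≤ μ / 2 ∧ (1 + 2 * L) * η ≤ ηb := by
    refine ⟨min ε₁ (min ε₂ (min δ (min ηa (min ηb (min (μ / 2 / (1 + 2 * L))
      (ηb / (1 + 2 * L))))))), by positivity, by simp, by simp, by simp, by simp, by simp, ?_, ?_⟩
    all_goals set η := min ε₁ (min ε₂ (min δ (min ηa (min ηb (min (μ / 2 / (1 + 2 * L))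
      (ηb / (1 + 2 * L))))))) with hη
    · have : η ≤ μ / 2 / (1 + 2 * L) := by simp [hη]
      rwa [le_div_iff₀ (by positivity), mul_comm] at this
    · have : η ≤ ηb / (1 + 2 * L) := by simp [hη]
      rwa [le_div_iff₀ (by positivity), mul_comm] at this
  refine ⟨η, hη, fun v p q hv hp hq => ?_⟩
  set ζ : X → X := fun x => v - f x p q - vh + s • (x - xb) with hζ
  have hζb : ∀ x, ‖x - xb‖ ≤ ρ₁ → ‖ζ x‖ < (1 + 2 * L) * η + (L + s) * ‖x - xb‖ := by
    intro x hx
    have e : ζ x = (v - vb) - (f x p q - f xb pb qb) + s • (x - xb) := by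
      simp only [hζ, hvh]; abel
    have l1 := hlip x xb p pb q qb (by linarith) (by simpa) (by linarith) (by simpa)
      (by linarith) (by simpa)
    have l2 : L * (‖x - xb‖ + dist p pb + dist q qb) ≤ L * (‖x - xb‖ + η + η) := by gcongr
    have l3 := norm_add_le ((v - vb) - (f x p q - f xb pb qb)) (s • (x - xb))
    have l4 := norm_sub_le (v - vb) (f x p q - f xb pb qb)
    rw [norm_smul, Real.norm_of_nonneg hs0.le] at l3
    rw [e]
    linarith
  have hζμ : ∀ x, ‖x - xb‖ ≤ ρ₁ → ‖ζ x‖ < μ := by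
    intro x hx
    have l1 : (L + s) * ‖x - xb‖ ≤ (L + s) * ρ₁ := by gcongr
    linarith [hζb x hx]
  have hζlip : ∀ x y, ‖x - xb‖ ≤ ρ₁ → ‖y - xb‖ ≤ ρ₁ →
      ‖ζ x - ζ y‖ ≤ θ * (s - r) * ‖x - y‖ := by
    intro x y hx hy
    have e : ζ x - ζ y = s • (x - y) - (f x p q - f y p q) := by simp only [hζ]; module
    have l1 := hlip x y p p q q (by linarith) (by linarith) (by linarith) (by linarith)
      (by linarith) (by linarith)
    simp only [dist_self, add_zero] at l1
    have l2 := hmono x y p q (by linarith) (by linarith) (by linarith) (by linarith)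
    have l3 : ‖ζ x - ζ y‖ ^ 2 ≤ (s ^ 2 - 2 * s * σ + L ^ 2) * ‖x - y‖ ^ 2 := by
      rw [e, norm_sub_sq_real, norm_smul, Real.norm_of_nonneg hs0.le, real_inner_smul_left,
        real_inner_comm]
      have l4 : ‖f x p q - f y p q‖ ^ 2 ≤ (L * ‖x - y‖) ^ 2 := by gcongr
      have l5 := mul_le_mul_of_nonneg_left l2 hs0.le
      linarith
    rw [hθs]
    calc ‖ζ x - ζ y‖ = √(‖ζ x - ζ y‖ ^ 2) := (Real.sqrt_sq (norm_nonneg _)).symm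
      _ ≤ √((s ^ 2 - 2 * s * σ + L ^ 2) * ‖x - y‖ ^ 2) := Real.sqrt_le_sqrt l3
      _ = _ := by rw [Real.sqrt_mul' _ (by positivity), Real.sqrt_sq (norm_nonneg _)]
  have hcontr : ∀ x₁ x₂ y₁ y₂, ‖x₁ - xb‖ ≤ ρ₁ → ‖x₂ - xb‖ ≤ ρ₁ → ‖y₁ - xb‖ < ρa →
      ‖y₂ - xb‖ < ρa → vh + ζ x₁ - s • (y₁ - xb) ∈ pSubdiff g y₁ p →
      vh + ζ x₂ - s • (y₂ - xb) ∈ pSubdiff g y₂ p → ‖y₁ - y₂‖ ≤ θ * ‖x₁ - x₂‖ := by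
    intro x₁ x₂ y₁ y₂ hx₁ hx₂ hy₁ hy₂ hm₁ hm₂
    have hnear : ∀ x y, ‖x - xb‖ ≤ ρ₁ → ‖y - xb‖ < ρa →
        ‖vh + ζ x - s • (y - xb) - vh‖ < δ := by
      intro x y hx hy
      have e : vh + ζ x - s • (y - xb) - vh = ζ x - s • (y - xb) := by abel
      have l1 := norm_sub_le (ζ x) (s • (y - xb))
      have l2 : s * ‖y - xb‖ ≤ s * ρa := by gcongr
      rw [norm_smul, Real.norm_of_nonneg hs0.le] at l1
      rw [e]
      linarith [hζμ x hx]
    have m1 := hhyp y₁ y₂ p p _ _ (by linarith) (by linarith) (by linarith) (by linarith)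
      (hnear x₁ y₁ hx₁ hy₁) (hnear x₂ y₂ hx₂ hy₂) hm₁ hm₂
    have e : vh + ζ x₁ - s • (y₁ - xb) - (vh + ζ x₂ - s • (y₂ - xb))
        = (ζ x₁ - ζ x₂) - s • (y₁ - y₂) := by module
    rw [e, inner_sub_left, real_inner_smul_left, real_inner_self_eq_norm_sq, dist_self] at m1
    have m2 := real_inner_le_norm (ζ x₁ - ζ x₂) (y₁ - y₂)
    have m3 : ‖ζ x₁ - ζ x₂‖ * ‖y₁ - y₂‖ ≤ θ * (s - r) * ‖x₁ - x₂‖ * ‖y₁ - y₂‖ := by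
      gcongr; exact hζlip x₁ x₂ hx₁ hx₂
    rcases (norm_nonneg (y₁ - y₂)).eq_or_lt with h0 | h0
    · rw [← h0]; positivity
    · have m4 : (s - r) * ‖y₁ - y₂‖ * ‖y₁ - y₂‖
          ≤ (s - r) * (θ * ‖x₁ - x₂‖) * ‖y₁ - y₂‖ := by linarith
      exact le_of_mul_le_mul_left (le_of_mul_le_mul_right m4 h0) hsr
  have hT : ∀ x, ∃ y, ‖x - xb‖ ≤ ρ₁ → ‖y - xb‖ < ρa ∧
      vh + ζ x - s • (y - xb) ∈ pSubdiff g y p := by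
    intro x
    by_cases hx : ‖x - xb‖ ≤ ρ₁
    · obtain ⟨y, hy⟩ := hresa p (ζ x) (by linarith) ((hζμ x hx).trans_le hμa)
      exact ⟨y, fun _ => hy⟩
    · exact ⟨x, fun h => absurd h hx⟩
  choose T hT using hT
  have hxb0 : ‖xb - xb‖ ≤ ρ₁ := by simpa using hρ₁.le
  obtain ⟨y₀, hy₀, hy₀m⟩ := hresb p (ζ xb) (by linarith) (by
    have := hζb xb hxb0
    rw [sub_self, norm_zero, mul_zero, add_zero] at this
    linarith)
  rw [lt_min_iff] at hy₀
  have hball : ∀ x, x ∈ closedBall xb ρ₁ ↔ ‖x - xb‖ ≤ ρ₁ := fun x => mem_closedBall_iff_norm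
  have hmaps : MapsTo T (closedBall xb ρ₁) (closedBall xb ρ₁) := by
    intro x hx
    rw [hball] at hx ⊢
    have l1 := hcontr x xb (T x) y₀ hx hxb0 (hT x hx).1 hy₀.1 (hT x hx).2 hy₀m
    have l2 := norm_sub_le_norm_sub_add_norm_sub (T x) y₀ xb
    have l3 : θ * ‖x - xb‖ ≤ θ * ρ₁ := by gcongr
    linarith [hy₀.2]
  have hcw : ContractingWith ⟨θ, hθ0⟩ (hmaps.restrict T _ _) := by
    refine ⟨by exact_mod_cast hθ1, LipschitzWith.of_dist_le_mul fun a b => ?_⟩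
    have ha := (hball _).1 a.2
    have hb := (hball _).1 b.2
    rw [Subtype.dist_eq, Subtype.dist_eq, dist_eq_norm, dist_eq_norm]
    exact hcontr _ _ _ _ ha hb (hT _ ha).1 (hT _ hb).1 (hT _ ha).2 (hT _ hb).2
  obtain ⟨x, hx, hfix, -⟩ := ContractingWith.exists_fixedPoint' isClosed_closedBall.isComplete hmaps
    hcw (mem_closedBall_self hρ₁.le) (edist_ne_top _ _)
  have hx' := (hball x).1 hx
  refine ⟨x, by linarith, ?_⟩
  have hm := (hT x hx').2
  rw [hfix.eq] at hm
  have e : vh + ζ x - s • (x - xb) = v - f x p q := by simp only [hζ]; abel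
  rwa [e] at hm

/-- The quantitative inequality behind full stability, for vectors in an inner product space. -/
theorem norm_sub_smul_le_of_strong_monotone {a b : X} {κ α β : ℝ} (hκ : 0 < κ) (hα : 0 ≤ α)
    (hβ : 0 ≤ β) (h : κ * ‖b‖ ^ 2 ≤ ⟪a, b⟫ + α + β * ‖b‖) :
    ‖a - κ • b‖ ≤ ‖a‖ + (√(2 * κ * α) + β) := by
  refine le_of_pow_le_pow_left₀ two_ne_zero (by positivity) ?_
  rw [norm_sub_sq_real, norm_smul, Real.norm_of_nonneg hκ.le, real_inner_smul_right]
  have hs := Real.sq_sqrt (show 0 ≤ 2 * κ * α by positivity)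
  have h1 := mul_le_mul_of_nonneg_left h hκ.le
  have h2 := sq_nonneg (κ * ‖b‖ - β)
  have h3 : 0 ≤ ‖a‖ * (√(2 * κ * α) + β) := by positivity
  have h4 : 0 ≤ √(2 * κ * α) * β := by positivity
  linarith

/-- Hölderian full stability of nonsmooth PVS under strong
monotonicity (Theorem 7.1). -/
theorem statement10
    {X : Type*} [NormedAddCommGroup X] [InnerProductSpace ℝ X] [CompleteSpace X]
    {P : Type*} [MetricSpace P] {Q : Type*} [MetricSpace Q]
    (f : X → P → Q → X) (g : X → P → EReal)
    (xb vb vh : X) (pb : P) (qb : Q)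
    (hg_lsc : LowerSemicontinuous fun t : X × P => g t.1 t.2)
    (hg_proper : ∀ x p, g x p ≠ ⊥)
    (hvh : vh = vb - f xb pb qb)
    (hsol : xb ∈ SolMap f g vb pb qb)
    (hA1 : A1 f xb pb qb) (hA2 : A2 g xb pb vh) (hA3 : A3 g xb pb)
    (σ : ℝ) (hmono : StrongMono f xb pb qb σ)
    (hσ : proxThreshold g xb pb vh < σ) :
    HolderFullStable (SolMap f g) xb vb pb qb := by
  obtain ⟨r, ⟨hr, hprox⟩, hrσ⟩ := exists_lt_of_csInf_lt hA2.1 hσ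
  have hmem : vh ∈ pSubdiff g xb pb := by rw [hvh]; exact hsol
  obtain ⟨ε, ν, ℓ, γ, hd⟩ := exists_localData hg_lsc hg_proper hmem hr hprox hA2.2 hA3
  have hg_lsc' : ∀ p, LowerSemicontinuous fun x => g x p := fun p =>
    hg_lsc.comp (Continuous.prodMk_left p)
  obtain ⟨C, hC, L, hL, δ, hδ, hest⟩ := hd.solMap_strong_monotone hvh hA1 hmono
  obtain ⟨η, hη, hsolv⟩ := hd.exists_solution hg_lsc' hvh hA1 hmono hrσ hδ
  have hκ : 0 < σ - r := sub_pos.2 hrσ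
  obtain ⟨ρ, hρ, hρδ, hρη⟩ : ∃ ρ > 0, ρ ≤ δ ∧ ρ ≤ η :=
    ⟨min δ η, by positivity, by simp, by simp⟩
  have hex : ∀ v p q, ∃ x, v ∈ ball vb ρ → p ∈ ball pb ρ → q ∈ ball qb ρ →
      ‖x - xb‖ < δ ∧ x ∈ SolMap f g v p q := by
    intro v p q
    by_cases h : v ∈ ball vb ρ ∧ p ∈ ball pb ρ ∧ q ∈ ball qb ρ
    · obtain ⟨hv, hp, hq⟩ := h
      rw [mem_ball_iff_norm] at hv
      obtain ⟨x, hx⟩ := hsolv v p q (hv.trans_le hρη) (hp.trans_le hρη) (hq.trans_le hρη)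
      exact ⟨x, fun _ _ _ => hx⟩
    · exact ⟨xb, fun hv hp hq => absurd ⟨hv, hp, hq⟩ h⟩
  choose ϑ hϑ using hex
  have hest' : ∀ v₁ v₂ p₁ p₂ q₁ q₂ x₁ x₂, v₁ ∈ ball vb ρ → v₂ ∈ ball vb ρ →
      p₁ ∈ ball pb ρ → p₂ ∈ ball pb ρ → q₁ ∈ ball qb ρ → q₂ ∈ ball qb ρ →
      ‖x₁ - xb‖ < δ ∧ x₁ ∈ SolMap f g v₁ p₁ q₁ → ‖x₂ - xb‖ < δ ∧ x₂ ∈ SolMap f g v₂ p₂ q₂ →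
      (σ - r) * ‖x₁ - x₂‖ ^ 2
        ≤ ⟪v₁ - v₂, x₁ - x₂⟫ + C * dist p₁ p₂ + L * dist q₁ q₂ * ‖x₁ - x₂‖ := by
    intro v₁ v₂ p₁ p₂ q₁ q₂ x₁ x₂ hv₁ hv₂ hp₁ hp₂ hq₁ hq₂ hx₁ hx₂
    rw [mem_ball_iff_norm] at hv₁ hv₂
    exact hest v₁ v₂ p₁ p₂ q₁ q₂ x₁ x₂ (hv₁.trans_le hρδ) (hv₂.trans_le hρδ) (hp₁.trans_le hρδ)
      (hp₂.trans_le hρδ) (hq₁.trans_le hρδ) (hq₂.trans_le hρδ) hx₁.1 hx₂.1 hx₁.2 hx₂.2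
  refine ⟨(σ - r) / 2, by positivity, √(2 * (σ - r) * C) + L, by positivity, ball vb ρ,
    ball_mem_nhds _ hρ, ball pb ρ, ball_mem_nhds _ hρ, ball qb ρ, ball_mem_nhds _ hρ, ball xb δ,
    ball_mem_nhds _ hδ, ϑ, ?_, ?_⟩
  · intro v hv p hp q hq
    have h := hϑ v p q hv hp hq
    refine ⟨mem_ball_iff_norm.2 h.1, h.2, fun x hx hxS => ?_⟩
    have := hest' v v p p q q x _ hv hv hp hp hq hq ⟨mem_ball_iff_norm.1 hx, hxS⟩ h
    simp only [sub_self, inner_zero_left, dist_self, mul_zero, zero_mul, add_zero] at this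
    have h0 : ‖x - ϑ v p q‖ ^ 2 ≤ 0 := nonpos_of_mul_nonpos_right this hκ
    exact sub_eq_zero.1 (norm_eq_zero.1 (pow_eq_zero_iff two_ne_zero |>.1
      (le_antisymm h0 (sq_nonneg _))))
  · intro v₁ hv₁ p₁ hp₁ q₁ hq₁ v₂ hv₂ p₂ hp₂ q₂ hq₂
    have h := norm_sub_smul_le_of_strong_monotone hκ (by positivity) (by positivity)
      (hest' v₁ v₂ p₁ p₂ q₁ q₂ _ _ hv₁ hv₂ hp₁ hp₂ hq₁ hq₂ (hϑ v₁ p₁ q₁ hv₁ hp₁ hq₁)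
        (hϑ v₂ p₂ q₂ hv₂ hp₂ hq₂))
    rw [mul_div_cancel₀ _ (two_ne_zero' ℝ)]
    refine h.trans ?_
    rw [← mul_assoc (2 * (σ - r)) C, Real.sqrt_mul (by positivity)]
    gcongr
    have h1 : 0 ≤ √(2 * (σ - r) * C) * dist q₁ q₂ := by positivity
    have h2 : 0 ≤ L * √(dist p₁ p₂) := by positivity
    linarith

end PVS
end
end

section
/- Let x̄ ∈ S(v̄,p̄,q̄) be a solution of the parametric variational system v ∈ f(x,p,q) + ∂_x g(x,p) satisfying the standing assumptions (A1)–(A3), with ℛ the threshold of prox-regularity of g at (x̄,p̄) for v̂, and assume that f is locally strongly monotone in x around (x̄,p̄,q̄) with modulus σ > ℛ. Assume in addition that the set-valued map p ↦ gph ∂_x g(·,p) ⊂ X × X is Lipschitz-like around (p̄,(x̄,v̂)). Then x̄ is a Lipschitzian fully stable solution corresponding to (v̄,p̄,q̄). (No differentiability of f is assumed.) -/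
noncomputable section

open Filter Topology Metric Set MeasureTheory
open scoped RealInnerProductSpace Pointwise

namespace PVS

variable {X : Type*} [NormedAddCommGroup X] [InnerProductSpace ℝ X]
variable {Y : Type*} [NormedAddCommGroup Y] [InnerProductSpace ℝ Y]
variable {W : Type*} [NormedAddCommGroup W] [InnerProductSpace ℝ W]
variable {P : Type*} [MetricSpace P]
variable {Q : Type*} [MetricSpace Q]

/-- Uniform prox-regularity of a single function near a point of the graph of its
subdifferential. -/
def LocProxReg (h : X → EReal) (xb vh : X) (ε r : ℝ) : Prop :=
  ∀ x u v, ‖x - xb‖ < ε → ‖u - xb‖ < ε → ‖v - vh‖ < ε → v ∈ limSubdiff h u →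
    h u + ((⟪v, x - u⟫ - r / 2 * ‖x - u‖ ^ 2 : ℝ) : EReal) ≤ h x

theorem LocProxReg.ne_top {h : X → EReal} {xb vh u v : X} {ε r : ℝ}
    (H : LocProxReg h xb vh ε r) (hu : ‖u - xb‖ < ε) (hv : ‖v - vh‖ < ε)
    (hvu : v ∈ limSubdiff h u) : h u ≠ ⊤ := by
  intro htop
  obtain ⟨xs, vs, hxs, -, hreg, -⟩ := id hvu
  have hlim : Tendsto (fun k => ‖xs k - xb‖) atTop (𝓝 ‖u - xb‖) :=
    (hxs.sub_const xb).norm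
  obtain ⟨k, hk⟩ := (hlim.eventually_lt_const hu).exists
  have := H (xs k) u v hk hu hv hvu
  rw [htop, EReal.top_add_coe, top_le_iff] at this
  exact (hreg k).1 this

theorem LocProxReg.toReal_le {h : X → EReal} (hbot : ∀ x, h x ≠ ⊥) {xb vh x u v : X} {ε r : ℝ}
    (H : LocProxReg h xb vh ε r) (hx : ‖x - xb‖ < ε) (hu : ‖u - xb‖ < ε) (hv : ‖v - vh‖ < ε)
    (hvu : v ∈ limSubdiff h u) (hxt : h x ≠ ⊤) :
    (h u).toReal + (⟪v, x - u⟫ - r / 2 * ‖x - u‖ ^ 2) ≤ (h x).toReal := by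
  have := H x u v hx hu hv hvu
  rw [← EReal.coe_toReal (H.ne_top hu hv hvu) (hbot u), ← EReal.coe_toReal hxt (hbot x)] at this
  exact_mod_cast this

theorem LocProxReg.hypomonotone {h : X → EReal} (hbot : ∀ x, h x ≠ ⊥) {xb vh u₁ u₂ v₁ v₂ : X}
    {ε r : ℝ} (H : LocProxReg h xb vh ε r) (hu₁ : ‖u₁ - xb‖ < ε) (hu₂ : ‖u₂ - xb‖ < ε)
    (hv₁ : ‖v₁ - vh‖ < ε) (hv₂ : ‖v₂ - vh‖ < ε)
    (h₁ : v₁ ∈ limSubdiff h u₁) (h₂ : v₂ ∈ limSubdiff h u₂) :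
    -r * ‖u₁ - u₂‖ ^ 2 ≤ ⟪v₁ - v₂, u₁ - u₂⟫ := by
  have e₁ := H.toReal_le hbot hu₂ hu₁ hv₁ h₁ (H.ne_top hu₂ hv₂ h₂)
  have e₂ := H.toReal_le hbot hu₁ hu₂ hv₂ h₂ (H.ne_top hu₁ hv₁ h₁)
  rw [← neg_sub u₁ u₂, inner_neg_right, norm_neg] at e₁
  rw [inner_sub_left]
  linarith

/-- Strong limits of regular subgradients near the reference point are limiting subgradients. -/
theorem LocProxReg.mem_limSubdiff_of_tendsto {h : X → EReal} (hlsc : LowerSemicontinuous h)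
    {xb vh y u : X} {ε r : ℝ} (H : LocProxReg h xb vh ε r) {ys us : ℕ → X}
    (hreg : ∀ k, us k ∈ regSubdiff h (ys k)) (hys : ∀ k, ‖ys k - xb‖ < ε)
    (hus : ∀ k, ‖us k - vh‖ < ε) (hy : ‖y - xb‖ < ε)
    (hty : Tendsto ys atTop (𝓝 y)) (htu : Tendsto us atTop (𝓝 u)) :
    u ∈ limSubdiff h y := by
  refine ⟨ys, us, hty, ?_, hreg, fun z => htu.inner tendsto_const_nhds⟩
  refine tendsto_order.2 ⟨fun a ha => hty.eventually (hlsc y a ha), fun a ha => ?_⟩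
  have hreal : Tendsto (fun k => ⟪us k, y - ys k⟫ - r / 2 * ‖y - ys k‖ ^ 2) atTop (𝓝 0) := by
    have h1 : Tendsto (fun k => y - ys k) atTop (𝓝 0) := by
      simpa using (tendsto_const_nhds (x := y)).sub hty
    have := (htu.inner (𝕜 := ℝ) h1).sub ((h1.norm.pow 2).const_mul (r / 2))
    simpa using this
  obtain ⟨b, hyb, hba⟩ := EReal.lt_iff_exists_real_btwn.1 ha
  obtain ⟨c, hyc, hcb⟩ := EReal.lt_iff_exists_real_btwn.1 hyb
  have hcb' : c - b < 0 := by
    have : c < b := by exact_mod_cast hcb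
    linarith
  filter_upwards [hreal.eventually_const_lt hcb'] with k hk
  have hle := H y (ys k) (us k) hy (hys k) (hus k) (regSubdiff_subset_limSubdiff h _ (hreg k))
  refine lt_trans ?_ hba
  have hle2 := hle.trans_lt hyc
  rw [← EReal.coe_toReal (hreg k).1 (hreg k).2.1] at hle2 ⊢
  have hle3 : (h (ys k)).toReal + (⟪us k, y - ys k⟫ - r / 2 * ‖y - ys k‖ ^ 2) < c := by
    exact_mod_cast hle2
  have : (h (ys k)).toReal < b := by linarith
  exact_mod_cast this

/-- A smooth variational principle of Borwein–Preiss type on bounded sets of a Hilbert space. -/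
theorem exists_quadratic_support_s11 [CompleteSpace X] {D : Set X} {H : X → ℝ}
    (hcl : IsClosed {t : X × ℝ | t.1 ∈ D ∧ H t.1 ≤ t.2}) {R m : ℝ}
    (hR : ∀ x ∈ D, ∀ x' ∈ D, ‖x - x'‖ ≤ R) (hm : ∀ x ∈ D, m ≤ H x) {x₀ : X} (hx₀ : x₀ ∈ D)
    {c : ℝ} (hc : 0 < c) :
    ∃ y ∈ D, ∃ e : X, ‖e‖ ≤ c ∧ H y ≤ H x₀ ∧
      ∀ x ∈ D, H y + ⟪e, x - y⟫ - c * ‖x - y‖ ^ 2 ≤ H x := by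
  have hR0 : 0 ≤ R := by simpa using hR x₀ hx₀ x₀ hx₀
  have step : ∀ (x : X) (q : X → ℝ) (ε : ℝ), x ∈ D → (∀ u, 0 ≤ q u) → 0 < ε →
      ∃ x' ∈ D, H x' + q x' ≤ H x + q x ∧ ∀ u ∈ D, H x' + q x' ≤ H u + q u + ε := by
    intro x q ε hx hq hε
    by_cases hmin : ∀ u ∈ D, H x + q x ≤ H u + q u + ε
    · exact ⟨x, hx, le_rfl, hmin⟩
    have hbdd : BddBelow ((fun u => H u + q u) '' D) :=
      ⟨m, by rintro _ ⟨u, hu, rfl⟩; linarith [hm u hu, hq u]⟩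
    have hne : ((fun u => H u + q u) '' D).Nonempty := ⟨_, x, hx, rfl⟩
    obtain ⟨_, ⟨x', hx', rfl⟩, hlt⟩ := exists_lt_of_csInf_lt hne
      (lt_add_of_pos_right (sInf ((fun u => H u + q u) '' D)) hε)
    have hle : ∀ u ∈ D, H x' + q x' ≤ H u + q u + ε := fun u hu => by
      have := csInf_le hbdd ⟨u, hu, rfl⟩
      simp only at this hlt
      linarith
    push Not at hmin
    obtain ⟨u, hu, hlt'⟩ := hmin
    exact ⟨x', hx', by linarith [hle u hu], hle⟩
  set δ : ℝ := c / (1 + 2 * R) with hδ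
  have hδ0 : 0 < δ := by positivity
  set cf : ℕ → ℝ := fun n => δ / 2 / 2 ^ n with hcf
  have hcf0 : ∀ n, 0 < cf n := fun n => by positivity
  have hcfs : HasSum cf δ := hasSum_geometric_two' δ
  set η : ℕ → ℝ := fun n => (1 / 2) ^ n with hη
  have hη0 : ∀ n, 0 < η n := fun n => by positivity
  have hηt : Tendsto η atTop (𝓝 0) := tendsto_pow_atTop_nhds_zero_of_lt_one (by norm_num)
    (by norm_num)
  choose! F hFD hFdec hFmin using step
  let st : ℕ → X × (X → ℝ) := fun n => Nat.rec (F x₀ 0 (cf 0 * η 0 ^ 2), 0)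
    (fun n s => (F s.1 (fun u => s.2 u + cf n * ‖u - s.1‖ ^ 2) (cf (n + 1) * η (n + 1) ^ 2),
      fun u => s.2 u + cf n * ‖u - s.1‖ ^ 2)) n
  set xs : ℕ → X := fun n => (st n).1 with hxs
  set q : ℕ → X → ℝ := fun n => (st n).2 with hq
  have hqs : ∀ n u, q (n + 1) u = q n u + cf n * ‖u - xs n‖ ^ 2 := fun n u => rfl
  have hq0 : ∀ n u, 0 ≤ q n u := by
    intro n
    induction n with
    | zero => exact fun u => le_rfl
    | succ n ih => intro u; rw [hqs]; have := ih u; have := hcf0 n; positivity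
  have hqsum : ∀ n u, q n u = ∑ i ∈ Finset.range n, cf i * ‖u - xs i‖ ^ 2 := by
    intro n u
    induction n with
    | zero => rfl
    | succ n ih => rw [hqs, Finset.sum_range_succ, ih]
  have hxS : ∀ n, xs (n + 1) = F (xs n) (q (n + 1)) (cf (n + 1) * η (n + 1) ^ 2) := fun n => rfl
  have hxD : ∀ n, xs n ∈ D := by
    intro n
    induction n with
    | zero =>
      exact hFD x₀ 0 _ hx₀ (fun _ => le_rfl) (mul_pos (hcf0 0) (pow_pos (hη0 0) 2))
    | succ n ih =>
      rw [hxS]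
      exact hFD _ _ _ ih (hq0 (n + 1)) (mul_pos (hcf0 _) (pow_pos (hη0 _) 2))
  have hxmin : ∀ n, ∀ u ∈ D, H (xs n) + q n (xs n) ≤ H u + q n u + cf n * η n ^ 2 := by
    intro n
    cases n with
    | zero =>
      exact hFmin x₀ 0 _ hx₀ (fun _ => le_rfl) (mul_pos (hcf0 0) (pow_pos (hη0 0) 2))
    | succ n =>
      rw [hxS]
      exact hFmin _ _ _ (hxD n) (hq0 (n + 1)) (mul_pos (hcf0 _) (pow_pos (hη0 _) 2))
  have hx0dec : H (xs 0) ≤ H x₀ := by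
    have := hFdec x₀ 0 (cf 0 * η 0 ^ 2) hx₀ (fun _ => le_rfl)
      (mul_pos (hcf0 0) (pow_pos (hη0 0) 2))
    have hx0 : xs 0 = F x₀ 0 (cf 0 * η 0 ^ 2) := rfl
    rw [hx0]
    simpa using this
  have hdec : Antitone fun n => H (xs n) + q n (xs n) := by
    refine antitone_nat_of_succ_le fun n => ?_
    have := hFdec (xs n) (q (n + 1)) (cf (n + 1) * η (n + 1) ^ 2) (hxD n) (hq0 (n + 1))
      (mul_pos (hcf0 _) (pow_pos (hη0 _) 2))
    rw [← hxS] at this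
    simpa [hqs n (xs n)] using this
  have hqmono : ∀ u, Monotone fun n => q n u := fun u => by
    refine monotone_nat_of_le_succ fun n => ?_
    rw [hqs]
    have := hcf0 n
    exact le_add_of_nonneg_right (by positivity)
  have htail : ∀ n k, n ≤ k → H (xs k) + q (n + 1) (xs k) ≤ H (xs n) + q n (xs n) := by
    intro n k hnk
    rcases hnk.eq_or_lt with rfl | hlt
    · simp [hqs]
    · exact (add_le_add_right (hqmono (xs k) hlt) _).trans (hdec hnk)
  have hdist : ∀ n k, n ≤ k → ‖xs k - xs n‖ ≤ η n := by
    intro n k hnk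
    have h1 := htail n k hnk
    have h2 := hxmin n (xs k) (hxD k)
    rw [hqs] at h1
    have h3 : cf n * ‖xs k - xs n‖ ^ 2 ≤ cf n * η n ^ 2 := by linarith
    exact le_of_sq_le_sq (le_of_mul_le_mul_left h3 (hcf0 n)) (hη0 n).le
  have hcauchy : CauchySeq xs := by
    refine cauchySeq_of_le_tendsto_0 (fun n => 2 * η n) (fun k l n hk hl => ?_)
      (by simpa using hηt.const_mul 2)
    rw [dist_eq_norm, ← sub_sub_sub_cancel_right (xs k) (xs l) (xs n)]
    linarith [norm_sub_le (xs k - xs n) (xs l - xs n), hdist n k hk, hdist n l hl]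
  obtain ⟨y, hy⟩ := cauchySeq_tendsto_of_complete hcauchy
  have hqcont : ∀ n, Continuous (q n) := by
    intro n
    have : q n = fun u => ∑ i ∈ Finset.range n, cf i * ‖u - xs i‖ ^ 2 := funext (hqsum n)
    rw [this]
    fun_prop
  have hylim : ∀ n, y ∈ D ∧ H y ≤ H (xs n) + q n (xs n) - q (n + 1) y := by
    intro n
    have hlim : Tendsto (fun k => (xs k, H (xs n) + q n (xs n) - q (n + 1) (xs k))) atTop
        (𝓝 (y, H (xs n) + q n (xs n) - q (n + 1) y)) :=
      hy.prodMk_nhds (tendsto_const_nhds.sub (((hqcont (n + 1)).tendsto y).comp hy))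
    refine hcl.mem_of_tendsto hlim ?_
    filter_upwards [eventually_ge_atTop n] with k hk
    exact ⟨hxD k, by linarith [htail n k hk]⟩
  have hyD := (hylim 0).1
  set ef : ℕ → X := fun n => (2 * cf n) • (xs n - y) with hef
  have hefn : ∀ n, ‖ef n‖ ≤ cf n * (2 * R) := fun n => by
    rw [hef, norm_smul, Real.norm_of_nonneg (by linarith [hcf0 n])]
    nlinarith [hR _ (hxD n) _ hyD, hcf0 n]
  have hefs : Summable ef := Summable.of_norm_bounded (hcfs.summable.mul_right _) hefn
  refine ⟨y, hyD, ∑' n, ef n, ?_, ?_, fun x hx => ?_⟩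
  · refine (tsum_of_norm_bounded (hcfs.mul_right (2 * R)) hefn).trans ?_
    rw [hδ, div_mul_eq_mul_div, div_le_iff₀ (by positivity)]
    nlinarith
  · have h1 := (hylim 0).2
    have h2 := hq0 1 y
    have h3 : q 0 (xs 0) = 0 := rfl
    rw [zero_add] at h1
    linarith
  · have hpart : ∀ n, H y + ⟪∑ i ∈ Finset.range n, ef i, x - y⟫ - δ * ‖x - y‖ ^ 2
        ≤ H x + cf n * η n ^ 2 := by
      intro n
      have h1 := (hylim n).2
      have h2 := hxmin n x hx
      have h3 := hqmono y n.le_succ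
      have h4 : q n x - q n y = (∑ i ∈ Finset.range n, cf i) * ‖x - y‖ ^ 2
          - ⟪∑ i ∈ Finset.range n, ef i, x - y⟫ := by
        rw [hqsum, hqsum, sum_inner, Finset.sum_mul, ← Finset.sum_sub_distrib,
          ← Finset.sum_sub_distrib]
        refine Finset.sum_congr rfl fun i _ => ?_
        have : ‖x - xs i‖ ^ 2 = ‖x - y‖ ^ 2 - 2 * ⟪x - y, xs i - y⟫ + ‖xs i - y‖ ^ 2 := by
          rw [← norm_sub_sq_real, sub_sub_sub_cancel_right]
        rw [this, hef, inner_smul_left, real_inner_comm, norm_sub_rev y]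
        simp only [conj_trivial]
        ring
      have h5 : ∑ i ∈ Finset.range n, cf i ≤ δ := sum_le_hasSum _ (fun i _ => (hcf0 i).le) hcfs
      have h6 := mul_le_mul_of_nonneg_right h5 (sq_nonneg ‖x - y‖)
      simp only at h3
      linarith
    have hδc : δ ≤ c := div_le_self hc.le (by linarith)
    have hl : Tendsto (fun n => H y + ⟪∑ i ∈ Finset.range n, ef i, x - y⟫ - δ * ‖x - y‖ ^ 2) atTop
        (𝓝 (H y + ⟪∑' n, ef n, x - y⟫ - δ * ‖x - y‖ ^ 2)) :=
      ((hefs.hasSum.tendsto_sum_nat.inner tendsto_const_nhds).const_add _).sub_const _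
    have hr : Tendsto (fun n => H x + cf n * η n ^ 2) atTop (𝓝 (H x)) := by
      have := (hcfs.summable.tendsto_atTop_zero.mul (hηt.pow 2)).const_add (H x)
      simpa using this
    have := le_of_tendsto_of_tendsto' hl hr hpart
    nlinarith [mul_le_mul_of_nonneg_right hδc (sq_nonneg ‖x - y‖)]

theorem LocProxReg.resolvent_lipschitz {h : X → EReal} (hbot : ∀ x, h x ≠ ⊥)
    {xb vh y₁ y₂ z₁ z₂ : X} {ε r s : ℝ} (H : LocProxReg h xb vh ε r)
    (hy₁ : ‖y₁ - xb‖ < ε) (hy₂ : ‖y₂ - xb‖ < ε)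
    (hz₁ : ‖z₁ - s • y₁ - vh‖ < ε) (hz₂ : ‖z₂ - s • y₂ - vh‖ < ε)
    (h₁ : z₁ - s • y₁ ∈ limSubdiff h y₁) (h₂ : z₂ - s • y₂ ∈ limSubdiff h y₂) :
    (s - r) * ‖y₁ - y₂‖ ≤ ‖z₁ - z₂‖ := by
  have hm := H.hypomonotone hbot hy₁ hy₂ hz₁ hz₂ h₁ h₂
  have hi : ⟪z₁ - s • y₁ - (z₂ - s • y₂), y₁ - y₂⟫ = ⟪z₁ - z₂, y₁ - y₂⟫ - s * ‖y₁ - y₂‖ ^ 2 := by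
    rw [sub_sub_sub_comm, ← smul_sub, inner_sub_left, real_inner_smul_left,
      real_inner_self_eq_norm_sq]
  have hc := real_inner_le_norm (z₁ - z₂) (y₁ - y₂)
  rcases (norm_nonneg (y₁ - y₂)).eq_or_lt with h0 | hpos
  · rw [← h0, mul_zero]; exact norm_nonneg _
  · refine le_of_mul_le_mul_right ?_ hpos
    nlinarith

theorem mem_regSubdiff_of_local_quadratic {h : X → EReal} (hbot : ∀ x, h x ≠ ⊥) {y u : X} {M : ℝ}
    (hy : h y ≠ ⊤)
    (hq : ∀ᶠ x in 𝓝 y, h x ≠ ⊤ →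
      (h y).toReal + (⟪u, x - y⟫ - M * ‖x - y‖ ^ 2) ≤ (h x).toReal) :
    u ∈ regSubdiff h y := by
  refine ⟨hy, hbot y, fun ε hε => ?_⟩
  have hsmall : ∀ᶠ x in 𝓝 y, M * ‖x - y‖ < ε := by
    have : Tendsto (fun x => M * ‖x - y‖) (𝓝 y) (𝓝 (M * ‖y - y‖)) :=
      Continuous.tendsto (by fun_prop) y
    exact this.eventually_lt_const (by simpa using hε)
  filter_upwards [hq, hsmall] with x hx hs
  by_cases hxt : h x = ⊤
  · rw [hxt]; exact le_top
  have h1 := hx hxt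
  rw [← EReal.coe_toReal hy (hbot y), ← EReal.coe_toReal hxt (hbot x)]
  have h2 := mul_le_mul_of_nonneg_right hs.le (norm_nonneg (x - y))
  have h3 : (h y).toReal + (⟪u, x - y⟫ - ε * ‖x - y‖) ≤ (h x).toReal := by nlinarith
  exact_mod_cast h3

/-- Approximate local resolvent: an arbitrarily small perturbation of the resolvent equation
has a solution near a given point of the graph. -/
theorem LocProxReg.exists_approx_resolvent [CompleteSpace X] {h : X → EReal}
    (hlsc : LowerSemicontinuous h) (hbot : ∀ x, h x ≠ ⊥)
    {xb vh x' v' z : X} {ε r s η ρ : ℝ} (H : LocProxReg h xb vh ε r)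
    (hrs : r < s) (hx' : ‖x' - xb‖ + ρ < ε) (hv' : ‖v' - vh‖ < ε) (hvx : v' ∈ limSubdiff h x')
    (hz : ‖z - (v' + s • x')‖ ≤ η) (hρ : 2 * η / (s - r) < ρ) {c : ℝ} (hc : 0 < c) :
    ∃ y e : X, ‖y - x'‖ ≤ 2 * η / (s - r) ∧ ‖e‖ ≤ c ∧ (z + e) - s • y ∈ regSubdiff h y := by
  have hμ : 0 < s - r := sub_pos.2 hrs
  have hη : 0 ≤ η := (norm_nonneg _).trans hz
  have hρ0 : 0 < ρ := lt_of_le_of_lt (by positivity) hρ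
  have hx'ε : ‖x' - xb‖ < ε := by linarith
  have hball : ∀ x ∈ closedBall x' ρ, ‖x - xb‖ < ε := fun x hx => by
    rw [mem_closedBall, dist_eq_norm] at hx
    linarith [norm_sub_le_norm_sub_add_norm_sub x x' xb]
  set D : Set X := {x | x ∈ closedBall x' ρ ∧ h x ≠ ⊤} with hD
  set φ : X → ℝ := fun x => s / 2 * ‖x‖ ^ 2 - ⟪z, x⟫ with hφ
  have hφc : Continuous φ := by fun_prop
  set G : X → ℝ := fun x => (h x).toReal + φ x with hG
  have hcl : IsClosed {t : X × ℝ | t.1 ∈ D ∧ G t.1 ≤ t.2} := by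
    have he : {t : X × ℝ | t.1 ∈ D ∧ G t.1 ≤ t.2} =
        (Prod.fst ⁻¹' closedBall x' ρ) ∩
          (fun t : X × ℝ => (t.1, ((t.2 - φ t.1 : ℝ) : EReal))) ⁻¹' {p | h p.1 ≤ p.2} := by
      ext ⟨x, t⟩
      simp only [hD, hG, mem_ofPred_eq, mem_inter_iff, mem_preimage, and_assoc]
      refine and_congr_right fun _ => ⟨fun ⟨hx, hle⟩ => ?_, fun hle => ?_⟩
      · rw [← EReal.coe_toReal hx (hbot x)]
        exact EReal.coe_le_coe_iff.2 (by linarith)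
      · have hx : h x ≠ ⊤ := (hle.trans_lt (EReal.coe_lt_top _)).ne
        refine ⟨hx, ?_⟩
        rw [← EReal.coe_toReal hx (hbot x)] at hle
        linarith [EReal.coe_le_coe_iff.1 hle]
    rw [he]
    refine (isClosed_closedBall.preimage continuous_fst).inter
      (hlsc.isClosed_epigraph.preimage ?_)
    exact continuous_fst.prodMk (continuous_coe_real_ereal.comp
      (continuous_snd.sub (hφc.comp continuous_fst)))
  have hx'D : x' ∈ D := ⟨mem_closedBall_self hρ0.le, H.ne_top hx'ε hv' hvx⟩
  have hgrow : ∀ x ∈ D, G x' - η * ‖x - x'‖ + (s - r) / 2 * ‖x - x'‖ ^ 2 ≤ G x := by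
    intro x hx
    have h1 := H.toReal_le hbot (hball x hx.1) hx'ε hv' hvx hx.2
    have h2 : ‖x‖ ^ 2 = ‖x'‖ ^ 2 + 2 * ⟪x', x - x'⟫ + ‖x - x'‖ ^ 2 := by
      rw [← norm_add_sq_real, add_sub_cancel]
    have h3 : ⟪z - (v' + s • x'), x - x'⟫ = ⟪z, x⟫ - ⟪z, x'⟫ - ⟪v', x - x'⟫ - s * ⟪x', x - x'⟫ := by
      rw [inner_sub_left, inner_add_left, real_inner_smul_left, inner_sub_right z]
      ring
    have h4 := real_inner_le_norm (z - (v' + s • x')) (x - x')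
    have h5 := mul_le_mul_of_nonneg_right hz (norm_nonneg (x - x'))
    simp only [hG, hφ, h2]
    nlinarith
  have hnear : ∀ x ∈ D, ‖x - x'‖ ≤ ρ := fun x hx => by
    simpa [dist_eq_norm] using hx.1
  obtain ⟨y, hyD, e, he, hle, hmin⟩ := exists_quadratic_support_s11 hcl (R := ρ + ρ)
    (m := G x' - η * ρ) (fun x hx u hu => by
      have := norm_sub_le (x - x') (u - x')
      rw [sub_sub_sub_cancel_right] at this
      linarith [hnear x hx, hnear u hu])
    (fun x hx => by
      have h1 := mul_le_mul_of_nonneg_left (hnear x hx) hη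
      have h2 : 0 ≤ (s - r) / 2 * ‖x - x'‖ ^ 2 := by positivity
      linarith [hgrow x hx]) hx'D hc
  have hyx : ‖y - x'‖ ≤ 2 * η / (s - r) := by
    rcases (norm_nonneg (y - x')).eq_or_lt with h0 | hpos
    · rw [← h0]; positivity
    · rw [le_div_iff₀ hμ]
      refine le_of_mul_le_mul_right ?_ hpos
      nlinarith [hgrow y hyD]
  refine ⟨y, e, hyx, he, mem_regSubdiff_of_local_quadratic hbot (M := c + s / 2) hyD.2 ?_⟩
  have hnb : closedBall x' ρ ∈ 𝓝 y :=
    mem_of_superset (isOpen_ball.mem_nhds (mem_ball_iff_norm.2 (hyx.trans_lt hρ)))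
      ball_subset_closedBall
  filter_upwards [hnb] with x hx hxt
  have h1 := hmin x ⟨hx, hxt⟩
  have h2 : ‖x‖ ^ 2 = ‖y‖ ^ 2 + 2 * ⟪y, x - y⟫ + ‖x - y‖ ^ 2 := by
    rw [← norm_add_sq_real, add_sub_cancel]
  have h3 : ⟪z + e - s • y, x - y⟫ = ⟪z, x⟫ - ⟪z, y⟫ + ⟪e, x - y⟫ - s * ⟪y, x - y⟫ := by
    rw [inner_sub_left, inner_add_left, real_inner_smul_left, inner_sub_right z]
  simp only [hG, hφ, h2] at h1
  rw [h3]
  linarith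

/-- Local solvability of the resolvent equation `z ∈ s • y + ∂h(y)`. -/
theorem LocProxReg.exists_resolvent [CompleteSpace X] {h : X → EReal}
    (hlsc : LowerSemicontinuous h) (hbot : ∀ x, h x ≠ ⊥)
    {xb vh x' v' z : X} {ε r s η : ℝ} (H : LocProxReg h xb vh ε r) (hε : 0 < ε)
    (hs : 1 ≤ s) (hrs : r < s) (hx' : ‖x' - xb‖ ≤ ε / 4) (hv' : ‖v' - vh‖ ≤ ε / 4)
    (hvx : v' ∈ limSubdiff h x') (hz : ‖z - (v' + s • x')‖ ≤ η)
    (hη : η + s * (2 * η / (s - r)) ≤ ε / 4) :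
    ∃ y : X, ‖y - xb‖ < ε ∧ ‖z - s • y - vh‖ < ε ∧ z - s • y ∈ limSubdiff h y := by
  have hμ : 0 < s - r := sub_pos.2 hrs
  have hη0 : 0 ≤ η := (norm_nonneg _).trans hz
  set κ := 2 * η / (s - r) with hκ
  have hκ0 : 0 ≤ κ := by positivity
  have hκε : κ ≤ ε / 4 := by nlinarith
  set c : ℕ → ℝ := fun k => ε / 8 * (1 / 2) ^ k with hcdef
  have hc0 : ∀ k, 0 < c k := fun k => by positivity
  have hcanti : Antitone c := fun a b hab =>
    mul_le_mul_of_nonneg_left (pow_le_pow_of_le_one (by norm_num) (by norm_num) hab) (by positivity)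
  have hclim : Tendsto c atTop (𝓝 0) := by
    have := (tendsto_pow_atTop_nhds_zero_of_lt_one (r := (1 / 2 : ℝ)) (by norm_num)
      (by norm_num)).const_mul (ε / 8)
    rwa [mul_zero] at this
  have hex : ∀ k, ∃ y e : X, ‖y - x'‖ ≤ κ ∧ ‖e‖ ≤ c k ∧ (z + e) - s • y ∈ regSubdiff h y :=
    fun k => H.exists_approx_resolvent hlsc hbot (ρ := ε / 2) hrs (by linarith) (by linarith)
      hvx hz (by linarith) (hc0 k)
  choose ys es hys hes hreg using hex
  have hnear : ∀ y : X, ‖y - x'‖ ≤ κ → ‖y - xb‖ < ε := fun y hy => by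
    linarith [norm_sub_le_norm_sub_add_norm_sub y x' xb]
  have hdual : ∀ y e : X, ‖y - x'‖ ≤ κ → ‖e‖ ≤ ε / 8 → ‖z + e - s • y - vh‖ < ε := by
    intro y e hy he
    have hsplit : z + e - s • y - vh
        = (z - (v' + s • x')) + e + s • (x' - y) + (v' - vh) := by
      rw [smul_sub]; abel
    have hsn : ‖s • (x' - y)‖ ≤ s * κ := by
      rw [norm_smul, Real.norm_of_nonneg (by linarith), norm_sub_rev]
      exact mul_le_mul_of_nonneg_left hy (by linarith)
    rw [hsplit]
    have := norm_add₄_le (a := z - (v' + s • x')) (b := e) (c := s • (x' - y)) (d := v' - vh)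
    linarith
  have hesε : ∀ k, ‖es k‖ ≤ ε / 8 := fun k =>
    (hes k).trans ((hcanti (Nat.zero_le k)).trans (by simp [hcdef]))
  have hcauchy : CauchySeq ys := by
    refine cauchySeq_of_le_tendsto_0 (fun n => 2 * c n / (s - r)) (fun k l n hk hl => ?_)
      (by simpa using (hclim.const_mul 2).div_const (s - r))
    have h1 := H.resolvent_lipschitz hbot (hnear _ (hys k)) (hnear _ (hys l))
      (hdual _ _ (hys k) (hesε k)) (hdual _ _ (hys l) (hesε l))
      (regSubdiff_subset_limSubdiff h _ (hreg k)) (regSubdiff_subset_limSubdiff h _ (hreg l))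
    rw [add_sub_add_left_eq_sub] at h1
    rw [dist_eq_norm, le_div_iff₀ hμ]
    linarith [norm_sub_le (es k) (es l), hes k, hes l, hcanti hk, hcanti hl]
  obtain ⟨y, hy⟩ := cauchySeq_tendsto_of_complete hcauchy
  have hyκ : ‖y - x'‖ ≤ κ := le_of_tendsto' (hy.sub_const x').norm hys
  have hes0 : Tendsto es atTop (𝓝 0) := squeeze_zero_norm hes hclim
  refine ⟨y, hnear y hyκ, by simpa using hdual y 0 hyκ (by simpa using by positivity), ?_⟩
  refine H.mem_limSubdiff_of_tendsto hlsc hreg (fun k => hnear _ (hys k))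
    (fun k => hdual _ _ (hys k) (hesε k)) (hnear y hyκ) hy ?_
  simpa using (hes0.const_add z).sub (hy.const_smul s)

/-- Local solvability of `v ∈ F(x) + ∂h(x)` for a Lipschitz `F` whose strong monotonicity modulus
exceeds the prox-regularity parameter of `h`; the constant `δ` does not depend on `h` and `F`. -/
theorem exists_solution_near [CompleteSpace X] {ε L r σ ρ : ℝ} (hε : 0 < ε) (hL : 0 < L)
    (hr : 0 < r) (hrσ : r < σ) (hρ : 0 < ρ) :
    ∃ δ > 0, ∀ h : X → EReal, LowerSemicontinuous h → (∀ x, h x ≠ ⊥) →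
      ∀ (F : X → X) (xb vh x' v' v : X), LocProxReg h xb vh ε r →
      (∀ x₁ x₂, ‖x₁ - xb‖ < ε → ‖x₂ - xb‖ < ε → ‖F x₁ - F x₂‖ ≤ L * ‖x₁ - x₂‖) →
      (∀ x₁ x₂, ‖x₁ - xb‖ < ε → ‖x₂ - xb‖ < ε →
        σ * ‖x₁ - x₂‖ ^ 2 ≤ ⟪F x₁ - F x₂, x₁ - x₂⟫) →
      ‖x' - xb‖ ≤ ε / 4 → ‖v' - vh‖ ≤ ε / 4 → v' ∈ limSubdiff h x' → ‖v - F x' - v'‖ ≤ δ →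
      ∃ x, ‖x - x'‖ ≤ ρ ∧ v - F x ∈ limSubdiff h x := by
  have hσr : 0 < σ - r := sub_pos.2 hrσ
  set s : ℝ := r + 1 + L ^ 2 / (σ - r) with hs
  have hq : 0 < L ^ 2 / (σ - r) := by positivity
  have hs1 : 1 ≤ s := by linarith
  have hs0 : 0 < s := by linarith
  have hrs : r < s := by linarith
  have hμ : 0 < s - r := sub_pos.2 hrs
  set M : ℝ := s ^ 2 - 2 * s * σ + L ^ 2 with hM
  have hMμ : M < (s - r) ^ 2 := by
    have h1 : L ^ 2 / (σ - r) * (σ - r) = L ^ 2 := div_mul_cancel₀ _ hσr.ne'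
    have h2 : s * (σ - r) = (r + 1) * (σ - r) + L ^ 2 := by rw [hs, add_mul, h1]
    nlinarith [mul_pos hr hσr, sq_nonneg L]
  set k : ℝ := √(max M 0) / (s - r) with hk
  have hk0 : 0 ≤ k := by positivity
  have hk1 : k < 1 := by
    rw [hk, div_lt_one hμ, Real.sqrt_lt' hμ]
    exact max_lt hMμ (by positivity)
  have hkM : M ≤ ((s - r) * k) ^ 2 := by
    rw [hk, mul_div_cancel₀ _ hμ.ne', Real.sq_sqrt (le_max_right _ _)]
    exact le_max_left _ _
  set η : ℝ := ε / 4 / (1 + s * (2 / (s - r))) with hη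
  have hη0 : 0 < η := by positivity
  have hηε : η + s * (2 * η / (s - r)) ≤ ε / 4 := by
    have : η * (1 + s * (2 / (s - r))) = ε / 4 := div_mul_cancel₀ _ (by positivity)
    rw [← this]
    exact le_of_eq (by ring)
  set ρ₁ : ℝ := min ρ (min (ε / 4) (η / (2 * (L + s)))) with hρ₁
  have hρ₁0 : 0 < ρ₁ := by positivity
  have hρ₁ρ : ρ₁ ≤ ρ := min_le_left _ _
  have hρ₁ε : ρ₁ ≤ ε / 4 := (min_le_right _ _).trans (min_le_left _ _)
  have hρ₁η : (L + s) * ρ₁ ≤ η / 2 := by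
    have h1 : ρ₁ ≤ η / (2 * (L + s)) := (min_le_right _ _).trans (min_le_right _ _)
    rw [le_div_iff₀ (by positivity)] at h1
    linarith
  refine ⟨min (η / 2) ((s - r) * ((1 - k) * ρ₁)), ?_, ?_⟩
  · have : 0 < 1 - k := sub_pos.2 hk1
    positivity
  intro h hlsc hbot F xb vh x' v' v H hFL hFσ hx' hv' hvx hδ
  obtain ⟨hδ1, hδ2⟩ := le_min_iff.1 hδ
  have hball : ∀ x ∈ closedBall x' ρ₁, ‖x - xb‖ < ε := fun x hx => by
    rw [mem_closedBall, dist_eq_norm] at hx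
    linarith [norm_sub_le_norm_sub_add_norm_sub x x' xb]
  have hx'K : x' ∈ closedBall x' ρ₁ := mem_closedBall_self hρ₁0.le
  set z : X → X := fun x => v - F x + s • x with hz
  have hzL : ∀ x₁ ∈ closedBall x' ρ₁, ∀ x₂ ∈ closedBall x' ρ₁,
      ‖z x₁ - z x₂‖ ≤ (s - r) * k * ‖x₁ - x₂‖ := by
    intro x₁ h₁ x₂ h₂
    have hl := hFL x₁ x₂ (hball _ h₁) (hball _ h₂)
    have hm := hFσ x₁ x₂ (hball _ h₁) (hball _ h₂)
    have he : z x₁ - z x₂ = s • (x₁ - x₂) - (F x₁ - F x₂) := by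
      simp only [hz, smul_sub]; abel
    refine le_of_sq_le_sq ?_ (by positivity)
    rw [he, norm_sub_sq_real, norm_smul, Real.norm_of_nonneg hs0.le, real_inner_smul_left,
      real_inner_comm]
    have h1 : ‖F x₁ - F x₂‖ ^ 2 ≤ (L * ‖x₁ - x₂‖) ^ 2 := by gcongr
    have h2 := mul_le_mul_of_nonneg_right hkM (sq_nonneg ‖x₁ - x₂‖)
    have h3 := mul_le_mul_of_nonneg_left hm hs0.le
    rw [hM] at h2
    nlinarith
  have hzx' : ‖z x' - (v' + s • x')‖ ≤ (s - r) * ((1 - k) * ρ₁) := by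
    have : z x' - (v' + s • x') = v - F x' - v' := by simp only [hz]; abel
    rwa [this]
  have hres : ∀ x ∈ closedBall x' ρ₁, ∃ y : X, ‖y - xb‖ < ε ∧ ‖z x - s • y - vh‖ < ε ∧
      z x - s • y ∈ limSubdiff h y := by
    intro x hx
    refine H.exists_resolvent hlsc hbot hε hs1 hrs hx' hv' hvx ?_ hηε
    have he : z x - (v' + s • x') = (v - F x' - v') + (F x' - F x) + s • (x - x') := by
      simp only [hz, smul_sub]; abel
    have hl := hFL x' x (hball _ hx'K) (hball _ hx)
    rw [mem_closedBall, dist_eq_norm] at hx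
    rw [norm_sub_rev x' x] at hl
    have hn : ‖s • (x - x')‖ = s * ‖x - x'‖ := by rw [norm_smul, Real.norm_of_nonneg hs0.le]
    have h1 := norm_add₃_le (a := v - F x' - v') (b := F x' - F x) (c := s • (x - x'))
    have h2 := mul_le_mul_of_nonneg_left hx (add_pos hL hs0).le
    rw [he]
    linarith
  choose! Θ hΘ1 hΘ2 hΘ3 using hres
  have hΘL : ∀ x₁ ∈ closedBall x' ρ₁, ∀ x₂ ∈ closedBall x' ρ₁,
      ‖Θ x₁ - Θ x₂‖ ≤ k * ‖x₁ - x₂‖ := by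
    intro x₁ h₁ x₂ h₂
    have := (H.resolvent_lipschitz hbot (hΘ1 x₁ h₁) (hΘ1 x₂ h₂) (hΘ2 x₁ h₁) (hΘ2 x₂ h₂)
      (hΘ3 x₁ h₁) (hΘ3 x₂ h₂)).trans (hzL x₁ h₁ x₂ h₂)
    rw [mul_assoc] at this
    exact le_of_mul_le_mul_left this hμ
  have hmaps : MapsTo Θ (closedBall x' ρ₁) (closedBall x' ρ₁) := by
    intro x hx
    have h1 := H.resolvent_lipschitz (z₂ := v' + s • x') hbot (hΘ1 x hx) (hball _ hx'K) (hΘ2 x hx)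
      (by simpa using by linarith) (hΘ3 x hx) (by simpa using hvx)
    have h2 := norm_sub_le_norm_sub_add_norm_sub (z x) (z x') (v' + s • x')
    have h3 := hzL x hx x' hx'K
    rw [mem_closedBall, dist_eq_norm] at hx ⊢
    refine le_of_mul_le_mul_left ?_ hμ
    have h4 := mul_le_mul_of_nonneg_left hx (mul_nonneg hμ.le hk0)
    linarith
  have hcontr : ContractingWith ⟨k, hk0⟩ (hmaps.restrict Θ _ _) :=
    ⟨by exact_mod_cast hk1, LipschitzWith.of_dist_le_mul fun a b => by
      rw [Subtype.dist_eq, Subtype.dist_eq, dist_eq_norm, dist_eq_norm]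
      exact hΘL a a.2 b b.2⟩
  obtain ⟨x, hx, hfix, -⟩ := hcontr.exists_fixedPoint' isClosed_closedBall.isComplete hmaps hx'K
    (edist_ne_top _ _)
  refine ⟨x, (by simpa [dist_eq_norm] using hx : ‖x - x'‖ ≤ ρ₁).trans hρ₁ρ, ?_⟩
  have := hΘ3 x hx
  rw [hfix.eq] at this
  simpa [hz] using this

/-- Lipschitzian full stability of nonsmooth PVS under strong
monotonicity (Theorem 7.5). -/
theorem statement11
    {X : Type*} [NormedAddCommGroup X] [InnerProductSpace ℝ X] [CompleteSpace X]
    {P : Type*} [MetricSpace P] {Q : Type*} [MetricSpace Q]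
    (f : X → P → Q → X) (g : X → P → EReal)
    (xb vb vh : X) (pb : P) (qb : Q)
    (hg_lsc : LowerSemicontinuous fun t : X × P => g t.1 t.2)
    (hg_proper : ∀ x p, g x p ≠ ⊥)
    (hvh : vh = vb - f xb pb qb)
    (hsol : xb ∈ SolMap f g vb pb qb)
    (hA1 : A1 f xb pb qb) (hA2 : A2 g xb pb vh) (hA3 : A3 g xb pb)
    (σ : ℝ) (hmono : StrongMono f xb pb qb σ)
    (hσ : proxThreshold g xb pb vh < σ)
    (hK : LipschitzLike (fun p => gphMap g p) pb (xb, vh)) :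
    LipFullStable (SolMap f g) xb vb pb qb := by
  obtain ⟨r, ⟨hr0, hprox⟩, hrσ⟩ : ∃ r ∈ {r : ℝ | 0 < r ∧ ProxRegWith g xb pb vh r}, r < σ :=
    exists_lt_of_csInf_lt hA2.1 hσ
  obtain ⟨ε₁, hε₁, hprox⟩ := hprox
  obtain ⟨L, hL, ε₂, hε₂, hlip⟩ := hA1
  obtain ⟨ε₃, hε₃, hmon⟩ := hmono
  obtain ⟨ℓ, hℓ, U₀, hU₀, V₀, hV₀, hK⟩ := hK
  obtain ⟨ε₄, hε₄, hU₀⟩ := Metric.mem_nhds_iff.1 hU₀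
  obtain ⟨ε₅, hε₅, hV₀⟩ := Metric.mem_nhds_iff.1 hV₀
  obtain ⟨ε, hε, hε1, hε2, hε3, hε4, hε5⟩ :
      ∃ ε > 0, ε ≤ ε₁ ∧ ε ≤ ε₂ ∧ ε ≤ ε₃ ∧ ε ≤ ε₄ ∧ ε ≤ ε₅ :=
    ⟨min ε₁ (min ε₂ (min ε₃ (min ε₄ ε₅))), by positivity, by simp, by simp, by simp, by simp,
      by simp⟩
  have hreg : ∀ p, dist p pb < ε → LocProxReg (fun x => g x p) xb vh ε r :=
    fun p hp x u v hx hu hv hvu => hprox x u p v (hx.trans_le hε1) (hu.trans_le hε1)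
      (hp.trans_le hε1) (hv.trans_le hε1) hvu
  have hlip' : ∀ x₁ x₂ p₁ p₂ q₁ q₂, ‖x₁ - xb‖ < ε → ‖x₂ - xb‖ < ε → dist p₁ pb < ε →
      dist p₂ pb < ε → dist q₁ qb < ε → dist q₂ qb < ε →
      ‖f x₁ p₁ q₁ - f x₂ p₂ q₂‖ ≤ L * (‖x₁ - x₂‖ + dist p₁ p₂ + dist q₁ q₂) :=
    fun x₁ x₂ p₁ p₂ q₁ q₂ h₁ h₂ h₃ h₄ h₅ h₆ => hlip x₁ x₂ p₁ p₂ q₁ q₂ (h₁.trans_le hε2)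
      (h₂.trans_le hε2) (h₃.trans_le hε2) (h₄.trans_le hε2) (h₅.trans_le hε2) (h₆.trans_le hε2)
  have hmon' : ∀ x₁ x₂ p q, ‖x₁ - xb‖ < ε → ‖x₂ - xb‖ < ε → dist p pb < ε → dist q qb < ε →
      σ * ‖x₁ - x₂‖ ^ 2 ≤ ⟪f x₁ p q - f x₂ p q, x₁ - x₂⟫ :=
    fun x₁ x₂ p q h₁ h₂ h₃ h₄ => hmon x₁ x₂ p q (h₁.trans_le hε3) (h₂.trans_le hε3)
      (h₃.trans_le hε3) (h₄.trans_le hε3)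
  have hgraph : ∀ p₁ p₂, dist p₁ pb < ε → dist p₂ pb < ε → ∀ x w, ‖x - xb‖ < ε → ‖w - vh‖ < ε →
      w ∈ pSubdiff g x p₁ → ∃ x' w', w' ∈ pSubdiff g x' p₂ ∧ ‖x - x'‖ ≤ ℓ * dist p₁ p₂ ∧
        ‖w - w'‖ ≤ ℓ * dist p₁ p₂ := by
    intro p₁ p₂ hp₁ hp₂ x w hx hw hwx
    have hmem : (x, w) ∈ ball (xb, vh) ε₅ := by
      rw [mem_ball_iff_norm, Prod.mk_sub_mk, Prod.norm_mk]
      exact max_lt (hx.trans_le hε5) (hw.trans_le hε5)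
    obtain ⟨⟨x', w'⟩, hw', hle⟩ := hK p₁ (hU₀ (hp₁.trans_le hε4)) p₂ (hU₀ (hp₂.trans_le hε4))
      (x, w) ⟨hwx, hV₀ hmem⟩
    rw [Prod.mk_sub_mk, Prod.norm_mk] at hle
    exact ⟨x', w', hw', (le_max_left _ _).trans hle, (le_max_right _ _).trans hle⟩
  set κ : ℝ := σ - r with hκ
  have hκ0 : 0 < κ := sub_pos.2 hrσ
  set τ : ℝ := ε / (1 + 3 * L + 2 * ℓ) with hτ
  have hτ0 : 0 < τ := by positivity
  have hτmul : τ + 3 * (L * τ) + 2 * (ℓ * τ) = ε := by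
    have : τ * (1 + 3 * L + 2 * ℓ) = ε := div_mul_cancel₀ _ (by positivity)
    linarith
  have hLτ : 0 < L * τ := by positivity
  have hℓτ : 0 < ℓ * τ := by positivity
  have hτε : τ < ε := by linarith
  have hdual : ∀ x v p q, ‖x - xb‖ < τ → ‖v - vb‖ < τ → dist p pb < τ → dist q qb < τ →
      ‖v - f x p q - vh‖ < τ + 3 * (L * τ) := by
    intro x v p q hx hv hp hq
    have h1 := hlip' x xb p pb q qb (hx.trans hτε) (by simpa using hε) (hp.trans hτε)
      (by simpa using hε) (hq.trans hτε) (by simpa using hε)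
    have h2 : L * (‖x - xb‖ + dist p pb + dist q qb) ≤ L * (3 * τ) :=
      mul_le_mul_of_nonneg_left (by linarith) hL.le
    have h3 : v - f x p q - vh = (v - vb) - (f x p q - f xb pb qb) := by rw [hvh]; abel
    rw [h3]
    linarith [norm_sub_le (v - vb) (f x p q - f xb pb qb)]
  set C : ℝ := 2 * (ℓ + L * (ℓ + 1)) + 2 * κ * ℓ with hC
  have hest : ∀ x₁ v₁ p₁ q₁ x₂ v₂ p₂ q₂, ‖x₁ - xb‖ < τ → ‖v₁ - vb‖ < τ → dist p₁ pb < τ →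
      dist q₁ qb < τ → ‖x₂ - xb‖ < τ → ‖v₂ - vb‖ < τ → dist p₂ pb < τ → dist q₂ qb < τ →
      x₁ ∈ SolMap f g v₁ p₁ q₁ → x₂ ∈ SolMap f g v₂ p₂ q₂ →
      ‖(v₁ - v₂) - (2 * κ) • (x₁ - x₂)‖ ≤ ‖v₁ - v₂‖ + C * (dist p₁ p₂ + dist q₁ q₂) := by
    intro x₁ v₁ p₁ q₁ x₂ v₂ p₂ q₂ hx₁ hv₁ hp₁ hq₁ hx₂ hv₂ hp₂ hq₂ hs₁ hs₂
    have hw₁ := hdual x₁ v₁ p₁ q₁ hx₁ hv₁ hp₁ hq₁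
    have hw₂ := hdual x₂ v₂ p₂ q₂ hx₂ hv₂ hp₂ hq₂
    obtain ⟨x', w', hw', hxx', hww'⟩ := hgraph p₁ p₂ (hp₁.trans hτε) (hp₂.trans hτε) x₁
      (v₁ - f x₁ p₁ q₁) (hx₁.trans hτε) (by linarith) hs₁
    have hpp : ℓ * dist p₁ p₂ < 2 * (ℓ * τ) := by
      have := dist_triangle_right p₁ p₂ pb
      nlinarith
    have hx' : ‖x' - xb‖ < ε := by
      have := norm_sub_le_norm_sub_add_norm_sub x' x₁ xb
      rw [norm_sub_rev x' x₁] at this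
      linarith
    have hw'ε : ‖w' - vh‖ < ε := by
      have := norm_sub_le_norm_sub_add_norm_sub w' (v₁ - f x₁ p₁ q₁) vh
      rw [norm_sub_rev w' (v₁ - f x₁ p₁ q₁)] at this
      linarith
    have hhyp := (hreg p₂ (hp₂.trans hτε)).hypomonotone (fun x => hg_proper x p₂) hx'
      (hx₂.trans hτε) hw'ε (by linarith) hw' hs₂
    have hfm := hmon' x' x₂ p₂ q₂ hx' (hx₂.trans hτε) (hp₂.trans hτε) (hq₂.trans hτε)
    have hfl := hlip' x' x₁ p₂ p₁ q₂ q₁ hx' (hx₁.trans hτε) (hp₂.trans hτε) (hp₁.trans hτε)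
      (hq₂.trans hτε) (hq₁.trans hτε)
    rw [norm_sub_rev x' x₁, dist_comm p₂, dist_comm q₂] at hfl
    set v' : X := w' + f x' p₂ q₂ with hv'
    have hin : κ * ‖x' - x₂‖ ^ 2 ≤ ⟪v' - v₂, x' - x₂⟫ := by
      have : v' - v₂ = (w' - (v₂ - f x₂ p₂ q₂)) + (f x' p₂ q₂ - f x₂ p₂ q₂) := by
        rw [hv']; abel
      rw [this, inner_add_left]
      linarith
    have hexp : ‖(v' - v₂) - (2 * κ) • (x' - x₂)‖ ≤ ‖v' - v₂‖ := by
      refine le_of_sq_le_sq ?_ (norm_nonneg _)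
      rw [norm_sub_sq_real, norm_smul, Real.norm_of_nonneg (by positivity), real_inner_smul_right]
      nlinarith
    have hvv : ‖v₁ - v'‖ ≤ ℓ * dist p₁ p₂ + L * (ℓ * dist p₁ p₂ + dist p₁ p₂ + dist q₁ q₂) := by
      have : v₁ - v' = (v₁ - f x₁ p₁ q₁ - w') - (f x' p₂ q₂ - f x₁ p₁ q₁) := by
        rw [hv']; abel
      rw [this]
      have h1 := norm_sub_le (v₁ - f x₁ p₁ q₁ - w') (f x' p₂ q₂ - f x₁ p₁ q₁)
      have h2 : L * (‖x₁ - x'‖ + dist p₁ p₂ + dist q₁ q₂)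
          ≤ L * (ℓ * dist p₁ p₂ + dist p₁ p₂ + dist q₁ q₂) := by gcongr
      linarith
    have hsplit : (v₁ - v₂) - (2 * κ) • (x₁ - x₂)
        = ((v' - v₂) - (2 * κ) • (x' - x₂)) + (v₁ - v') - (2 * κ) • (x₁ - x') := by
      simp only [smul_sub]; abel
    have h1 := norm_sub_le (((v' - v₂) - (2 * κ) • (x' - x₂)) + (v₁ - v')) ((2 * κ) • (x₁ - x'))
    have h2 := norm_add_le ((v' - v₂) - (2 * κ) • (x' - x₂)) (v₁ - v')
    have h3 : ‖v' - v₂‖ ≤ ‖v₁ - v'‖ + ‖v₁ - v₂‖ := by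
      rw [norm_sub_rev v₁ v']; exact norm_sub_le_norm_sub_add_norm_sub v' v₁ v₂
    rw [norm_smul, Real.norm_of_nonneg (by positivity : (0 : ℝ) ≤ 2 * κ)] at h1
    have h4 : 2 * κ * ‖x₁ - x'‖ ≤ 2 * κ * (ℓ * dist p₁ p₂) := by gcongr
    have h5 : 0 ≤ (2 * ℓ + 2 * (L * ℓ) + 2 * κ * ℓ) * dist q₁ q₂ := by positivity
    rw [hsplit, hC]
    linarith
  obtain ⟨δ, hδ0, hsolve⟩ := exists_solution_near (X := X) hε hL hr0 hrσ
    (half_pos hτ0)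
  obtain ⟨t, ht0, htτ, htℓ, htε, htδ⟩ : ∃ t > 0, t ≤ τ ∧ ℓ * t < τ / 2 ∧ ℓ * t ≤ ε / 4 ∧
      t + L * (ℓ * t + t + t) + ℓ * t ≤ δ := by
    have hev : ∀ φ : ℝ → ℝ, Continuous φ → φ 0 = 0 → ∀ a > 0, ∀ᶠ t in 𝓝[>] (0 : ℝ), φ t < a :=
      fun φ hφ h0 a ha => (hφ.tendsto' 0 0 h0).mono_left nhdsWithin_le_nhds |>.eventually_lt_const ha
    obtain ⟨t, ht0, h1, h2, h3, h4⟩ := ((eventually_mem_nhdsWithin (a := (0 : ℝ)) (s := Ioi 0)).and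
      ((hev (fun t => t) (by fun_prop) rfl τ hτ0).and
      ((hev (fun t => ℓ * t) (by fun_prop) (by simp) (τ / 2) (by positivity)).and
      ((hev (fun t => ℓ * t) (by fun_prop) (by simp) (ε / 4) (by positivity)).and
      (hev (fun t => t + L * (ℓ * t + t + t) + ℓ * t) (by fun_prop) (by simp) δ hδ0))))).exists
    exact ⟨t, ht0, h1.le, h2, h3.le, h4.le⟩
  have hex : ∀ v p q, ‖v - vb‖ < t → dist p pb < t → dist q qb < t →
      ∃ x, ‖x - xb‖ < τ ∧ x ∈ SolMap f g v p q := by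
    intro v p q hv hp hq
    have hpε : dist p pb < ε := by linarith
    have hqε : dist q qb < ε := by linarith
    have hvh' : vh ∈ pSubdiff g xb pb := by rw [hvh]; exact hsol
    obtain ⟨x', v', hv', hxx', hvv'⟩ := hgraph pb p (by simpa using hε) hpε xb vh
      (by simpa using hε) (by simpa using hε) hvh'
    rw [norm_sub_rev, dist_comm] at hxx' hvv'
    have hℓp : ℓ * dist p pb ≤ ℓ * t := by gcongr
    have hx' : ‖x' - xb‖ ≤ ε / 4 := by linarith
    have hv'ε : ‖v' - vh‖ ≤ ε / 4 := by linarith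
    have hfl := hlip' x' xb p pb q qb (by linarith) (by simpa using hε) hpε (by simpa using hε)
      hqε (by simpa using hε)
    have hδ : ‖v - f x' p q - v'‖ ≤ δ := by
      have he : v - f x' p q - v' = (v - vb) - (f x' p q - f xb pb qb) - (v' - vh) := by
        rw [hvh]; abel
      have h1 := norm_sub_le ((v - vb) - (f x' p q - f xb pb qb)) (v' - vh)
      have h2 := norm_sub_le (v - vb) (f x' p q - f xb pb qb)
      have h3 : L * (‖x' - xb‖ + dist p pb + dist q qb) ≤ L * (ℓ * t + t + t) := by
        gcongr
        exact hxx'.trans hℓp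
      rw [he]
      linarith
    obtain ⟨x, hx, hxs⟩ := hsolve (fun x => g x p)
      (hg_lsc.comp (g := fun x : X => (x, p)) (by fun_prop)) (fun x => hg_proper x p)
      (fun x => f x p q) xb vh x' v' v (hreg p hpε)
      (fun x₁ x₂ h₁ h₂ => by simpa using hlip' x₁ x₂ p p q q h₁ h₂ hpε hpε hqε hqε)
      (fun x₁ x₂ h₁ h₂ => hmon' x₁ x₂ p q h₁ h₂ hpε hqε) hx' hv'ε hv' hδ
    exact ⟨x, by linarith [norm_sub_le_norm_sub_add_norm_sub x x' xb], hxs⟩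
  choose! ϑ hϑτ hϑs using hex
  have hV : ∀ v ∈ ball vb t, ‖v - vb‖ < t := fun v hv => mem_ball_iff_norm.1 hv
  refine ⟨ball vb t, ball_mem_nhds _ ht0, ball pb t, ball_mem_nhds _ ht0, ball qb t,
    ball_mem_nhds _ ht0, ball xb τ, ball_mem_nhds _ hτ0, ϑ, fun v hv p hp q hq => ?_, κ, hκ0, C,
    by positivity, fun v₁ hv₁ p₁ hp₁ q₁ hq₁ v₂ hv₂ p₂ hp₂ q₂ hq₂ => ?_⟩
  · have hv := hV v hv
    refine ⟨mem_ball_iff_norm.2 (hϑτ v p q hv hp hq), hϑs v p q hv hp hq, fun x hx hxs => ?_⟩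
    have := hest x v p q (ϑ v p q) v p q (mem_ball_iff_norm.1 hx) (hv.trans_le htτ)
      (lt_of_lt_of_le hp htτ) (lt_of_lt_of_le hq htτ) (hϑτ v p q hv hp hq) (hv.trans_le htτ)
      (lt_of_lt_of_le hp htτ) (lt_of_lt_of_le hq htτ) hxs (hϑs v p q hv hp hq)
    rw [sub_self, zero_sub, norm_neg, norm_smul, norm_zero, dist_self, dist_self, add_zero,
      mul_zero, add_zero, Real.norm_of_nonneg (by positivity)] at this
    exact sub_eq_zero.1 (norm_le_zero_iff.1 (nonpos_of_mul_nonpos_right this (by positivity)))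
  · have hv₁ := hV v₁ hv₁
    have hv₂ := hV v₂ hv₂
    exact hest _ v₁ p₁ q₁ _ v₂ p₂ q₂ (hϑτ v₁ p₁ q₁ hv₁ hp₁ hq₁) (hv₁.trans_le htτ)
      (lt_of_lt_of_le hp₁ htτ) (lt_of_lt_of_le hq₁ htτ) (hϑτ v₂ p₂ q₂ hv₂ hp₂ hq₂)
      (hv₂.trans_le htτ) (lt_of_lt_of_le hp₂ htτ) (lt_of_lt_of_le hq₂ htτ)
      (hϑs v₁ p₁ q₁ hv₁ hp₁ hq₁) (hϑs v₂ p₂ q₂ hv₂ hp₂ hq₂)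

end PVS
end
end
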